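/- arXiv:math/0611363 — 13 statements merged into one kernel-verified Lean document; each statement's English description precedes it below -/
import Mathlib

section
/- Let 1 < p < ∞ and let λ = (λ_n)_{n≥1} be a nonnegative sequence in the class GBV satisfying ∑_{n=1}^∞ n^{p−2} λ_n^p < ∞. Let f : ℝ → ℝ be a 2π-periodic function such that for every x not an integer multiple of 2π the partial sums ∑_{k=1}^N λ_k cos(kx) converge to f(x) as N → ∞. Then there is a constant C > 0 (depending only on λ and p) such that for every n ≥ 1, sup_{0 < t ≤ 1/n} ( ∫_0^{2π} |f(x+t) − f(x)|^p dx )^{1/p} ≤ C n^{−1} ( ∑_{k=1}^{n−1} k^{2p−2} λ_k^p )^{1/p} + C ( ∑_{k=n}^∞ k^{p−2} λ_k^p )^{1/p}. -/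
open Filter MeasureTheory

/-- A nonnegative sequence whose variation over each dyadic block is controlled by its value at
the start of the block. -/
def IsGBV (M : ℝ) (a : ℕ → ℝ) : Prop :=
  (∀ n, 0 ≤ a n) ∧ ∀ m : ℕ, 1 ≤ m →
    ∑ n ∈ Finset.Icc m (2 * m), |a n - a (n + 1)| ≤ M * a m

namespace IsGBV

lemma le_mul {M : ℝ} {a : ℕ → ℝ} (ha : IsGBV M a) {m k : ℕ} (hm : 1 ≤ m) (hmk : m ≤ k)
    (hk : k ≤ 2 * m + 1) : a k ≤ (1 + M) * a m := by
  have h1 : a k - a m = ∑ n ∈ Finset.Ico m k, (a (n + 1) - a n) :=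
    (Finset.sum_Ico_sub a hmk).symm
  have h2 : ∑ n ∈ Finset.Ico m k, (a (n + 1) - a n) ≤
      ∑ n ∈ Finset.Ico m k, |a n - a (n + 1)| :=
    Finset.sum_le_sum fun n _ => by rw [abs_sub_comm]; exact le_abs_self _
  have h3 : ∑ n ∈ Finset.Ico m k, |a n - a (n + 1)| ≤
      ∑ n ∈ Finset.Icc m (2 * m), |a n - a (n + 1)| :=
    Finset.sum_le_sum_of_subset_of_nonneg
      (fun n hn => by simp only [Finset.mem_Ico, Finset.mem_Icc] at *; omega)
      fun _ _ _ => abs_nonneg _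
  linarith [ha.2 m hm]

lemma mul {M K : ℝ} {a w : ℕ → ℝ} (hM : 0 ≤ M) (ha : IsGBV M a) (hw : IsGBV K w) :
    IsGBV (M * (1 + K) + (1 + M) * K) (fun n => a n * w n) := by
  refine ⟨fun n => mul_nonneg (ha.1 n) (hw.1 n), fun m hm => ?_⟩
  have key : ∀ n ∈ Finset.Icc m (2 * m), |a n * w n - a (n + 1) * w (n + 1)| ≤
      |a n - a (n + 1)| * ((1 + K) * w m) + ((1 + M) * a m) * |w n - w (n + 1)| := by
    intro n hn
    rw [Finset.mem_Icc] at hn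
    have e : a n * w n - a (n + 1) * w (n + 1) =
        (a n - a (n + 1)) * w n + a (n + 1) * (w n - w (n + 1)) := by ring
    rw [e]
    refine (abs_add_le _ _).trans ?_
    rw [abs_mul, abs_mul, abs_of_nonneg (hw.1 n), abs_of_nonneg (ha.1 (n + 1))]
    exact add_le_add
      (mul_le_mul_of_nonneg_left (hw.le_mul hm hn.1 (by omega)) (abs_nonneg _))
      (mul_le_mul_of_nonneg_right (ha.le_mul hm (by omega) (by omega)) (abs_nonneg _))
  have hwm : 0 ≤ (1 + K) * w m := (hw.1 m).trans (hw.le_mul hm le_rfl (by omega))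
  have ham : 0 ≤ (1 + M) * a m := mul_nonneg (by linarith) (ha.1 m)
  calc _ ≤ _ := Finset.sum_le_sum key
    _ = (∑ n ∈ Finset.Icc m (2 * m), |a n - a (n + 1)|) * ((1 + K) * w m) +
        ((1 + M) * a m) * ∑ n ∈ Finset.Icc m (2 * m), |w n - w (n + 1)| := by
      rw [Finset.sum_add_distrib, Finset.sum_mul, Finset.mul_sum]
    _ ≤ (M * a m) * ((1 + K) * w m) + ((1 + M) * a m) * (K * w m) :=
      add_le_add (mul_le_mul_of_nonneg_right (ha.2 m hm) hwm)
        (mul_le_mul_of_nonneg_left (hw.2 m hm) ham)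
    _ = _ := by ring

lemma of_monotone {K : ℝ} {w : ℕ → ℝ} (h0 : ∀ n, 0 ≤ w n) (hw : Monotone w)
    (h : ∀ m, 1 ≤ m → w (2 * m + 1) ≤ (1 + K) * w m) : IsGBV K w := by
  refine ⟨h0, fun m hm => ?_⟩
  have e : ∀ n ∈ Finset.Icc m (2 * m), |w n - w (n + 1)| = w (n + 1) - w n := fun n _ => by
    rw [abs_sub_comm, abs_of_nonneg (sub_nonneg.2 (hw (Nat.le_succ n)))]
  rw [Finset.sum_congr rfl e, ← Finset.Ico_add_one_right_eq_Icc, Finset.sum_Ico_sub _ (by omega)]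
  linarith [h m hm]

lemma of_antitone {w : ℕ → ℝ} (h0 : ∀ n, 0 ≤ w n) (hw : Antitone w) : IsGBV 1 w := by
  refine ⟨h0, fun m hm => ?_⟩
  have e : ∀ n ∈ Finset.Icc m (2 * m), |w n - w (n + 1)| = -w (n + 1) - -w n := fun n _ => by
    rw [abs_of_nonneg (sub_nonneg.2 (hw (Nat.le_succ n)))]; ring
  rw [Finset.sum_congr rfl e, ← Finset.Ico_add_one_right_eq_Icc,
    Finset.sum_Ico_sub (fun n => -w n) (by omega)]
  linarith [h0 (2 * m + 1)]

/-- The variation of a GBV sequence beyond `N` is controlled by a logarithmic tail sum. -/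
lemma sum_variation_le {M : ℝ} {a : ℕ → ℝ} (ha : IsGBV M a) {N L : ℕ}
    (hN : 1 ≤ N) :
    ∑ k ∈ Finset.Icc N L, |a k - a (k + 1)| ≤
      2 * M * ∑ m ∈ Finset.Icc 1 L with N ≤ 2 * m, a m / m := by
  have h1 : ∀ k ∈ Finset.Icc N L, |a k - a (k + 1)| ≤
      ∑ m ∈ Finset.Icc 1 L with N ≤ 2 * m,
        if m ≤ k ∧ k ≤ 2 * m then 2 / (m : ℝ) * |a k - a (k + 1)| else 0 := by
    intro k hk
    rw [Finset.mem_Icc] at hk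
    have hk0 : (0 : ℝ) < k := by exact_mod_cast hN.trans hk.1
    rw [← Finset.sum_filter, ← Finset.sum_mul]
    refine le_mul_of_one_le_left (abs_nonneg _) ?_
    have hsub : Finset.Icc ((k + 1) / 2) k ⊆
        ((Finset.Icc 1 L).filter (fun m => N ≤ 2 * m)).filter (fun m => m ≤ k ∧ k ≤ 2 * m) := by
      intro m hm
      simp only [Finset.mem_Icc, Finset.mem_filter] at *
      omega
    calc (1 : ℝ) ≤ ∑ m ∈ Finset.Icc ((k + 1) / 2) k, 2 / (k : ℝ) := by
          rw [Finset.sum_const, Nat.card_Icc, nsmul_eq_mul, mul_div_assoc', le_div_iff₀ hk0]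
          have : k ≤ (k + 1 - (k + 1) / 2) * 2 := by omega
          rw [one_mul]
          exact_mod_cast this
      _ ≤ ∑ m ∈ Finset.Icc ((k + 1) / 2) k, 2 / (m : ℝ) := by
          refine Finset.sum_le_sum fun m hm => ?_
          rw [Finset.mem_Icc] at hm
          have hm0 : (0 : ℝ) < m := by
            have : 1 ≤ m := by omega
            exact_mod_cast this
          have : (m : ℝ) ≤ k := by exact_mod_cast hm.2
          gcongr
      _ ≤ _ := Finset.sum_le_sum_of_subset_of_nonneg hsub fun _ _ _ => by positivity
  calc _ ≤ _ := Finset.sum_le_sum h1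
    _ = ∑ m ∈ Finset.Icc 1 L with N ≤ 2 * m, 2 / (m : ℝ) *
          ∑ k ∈ Finset.Icc N L with m ≤ k ∧ k ≤ 2 * m, |a k - a (k + 1)| := by
        rw [Finset.sum_comm]
        refine Finset.sum_congr rfl fun m _ => ?_
        rw [← Finset.sum_filter, Finset.mul_sum]
    _ ≤ ∑ m ∈ Finset.Icc 1 L with N ≤ 2 * m, 2 / (m : ℝ) * (M * a m) := by
        refine Finset.sum_le_sum fun m hm => ?_
        simp only [Finset.mem_Icc, Finset.mem_filter] at hm
        refine mul_le_mul_of_nonneg_left (le_trans ?_ (ha.2 m hm.1.1)) (by positivity)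
        exact Finset.sum_le_sum_of_subset_of_nonneg
          (fun k hk => by simp only [Finset.mem_Icc, Finset.mem_filter] at *; omega)
          fun _ _ _ => abs_nonneg _
    _ = _ := by
        rw [Finset.mul_sum]
        exact Finset.sum_congr rfl fun m _ => by ring

end IsGBV

lemma one_sub_mul_sum_Ico_mul_pow (a : ℕ → ℝ) (z : ℂ) {N n : ℕ} (h : N ≤ n) :
    (1 - z) * ∑ k ∈ Finset.Ico N n, (a k : ℂ) * z ^ k =
      a N * z ^ N - a n * z ^ n +
        ∑ k ∈ Finset.Ico N n, ((a (k + 1) - a k : ℝ) : ℂ) * z ^ (k + 1) := by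
  induction n, h using Nat.le_induction with
  | base => simp
  | succ n hn ih =>
    rw [Finset.sum_Ico_succ_top hn, Finset.sum_Ico_succ_top hn, mul_add, ih]
    push_cast
    ring

lemma IsGBV.norm_sum_mul_exp_le {M : ℝ} {a : ℕ → ℝ} (hM : 0 ≤ M) (ha : IsGBV M a) {L : ℕ}
    (hL : ∀ k, L < k → a k = 0) {x : ℝ} (hx0 : 0 < x) (hxpi : x ≤ Real.pi) :
    ‖∑ k ∈ Finset.Icc 1 L, (a k : ℂ) * Complex.exp (Complex.I * x) ^ k‖ ≤
      (1 + 4 * Real.pi * M) * ∑ k ∈ Finset.Icc 1 L, min 1 (1 / (k * x)) * a k := by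
  set z := Complex.exp (Complex.I * x) with hz
  have hz1 : ‖z‖ = 1 := by rw [hz, mul_comm]; exact Complex.norm_exp_ofReal_mul_I x
  have hpi := Real.pi_pos
  have hz2 : 2 * x / Real.pi ≤ ‖1 - z‖ := by
    rw [norm_sub_rev, hz, Complex.norm_exp_I_mul_ofReal_sub_one, Real.norm_eq_abs]
    refine le_trans ?_ (le_abs_self _)
    have := Real.mul_le_sin (x := x / 2) (by linarith) (by linarith)
    calc 2 * x / Real.pi = 2 * (2 / Real.pi * (x / 2)) := by ring
      _ ≤ _ := by linarith
  set N := ⌊1 / x⌋₊ + 1 with hN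
  have hNx : 1 / x < N := by rw [hN]; push_cast; exact Nat.lt_floor_add_one _
  have hκ : ∀ k : ℕ, 0 ≤ min 1 (1 / ((k : ℝ) * x)) * a k := fun k =>
    mul_nonneg (le_min zero_le_one (by positivity)) (ha.1 k)
  set T := ∑ k ∈ Finset.Icc 1 L, min 1 (1 / ((k : ℝ) * x)) * a k with hT
  have hlow : ‖∑ k ∈ Finset.Icc 1 L with k < N, (a k : ℂ) * z ^ k‖ ≤ T := by
    refine (norm_sum_le _ _).trans (le_trans (Finset.sum_le_sum fun k hk => ?_)
      (Finset.sum_le_sum_of_subset_of_nonneg (Finset.filter_subset _ _) fun k _ _ => hκ k))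
    simp only [Finset.mem_Icc, Finset.mem_filter] at hk
    have hk0 : (0 : ℝ) < k := by exact_mod_cast hk.1.1
    have hkx : (k : ℝ) ≤ 1 / x := (Nat.le_floor_iff (by positivity)).1 (by omega)
    have : 1 ≤ 1 / ((k : ℝ) * x) := by
      rw [le_div_iff₀ hx0] at hkx
      rw [le_div_iff₀ (by positivity)]
      linarith
    rw [min_eq_left this, norm_mul, norm_pow, hz1, one_pow, mul_one, one_mul, Complex.norm_real,
      Real.norm_of_nonneg (ha.1 k)]
  have hhigh : ‖∑ k ∈ Finset.Icc 1 L with ¬ k < N, (a k : ℂ) * z ^ k‖ ≤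
      4 * Real.pi * M * T := by
    have hset : (Finset.Icc 1 L).filter (fun k => ¬ k < N) = Finset.Ico N (L + 1) := by
      ext k; simp only [Finset.mem_Icc, Finset.mem_filter, Finset.mem_Ico]; omega
    have hT0 : 0 ≤ T := Finset.sum_nonneg fun k _ => hκ k
    rw [hset]
    rcases lt_or_ge L N with hlt | hle
    · rw [Finset.Ico_eq_empty (by omega), Finset.sum_empty, norm_zero]
      positivity
    have hV := ha.sum_variation_le (N := N) (L := L) (by omega)
    set V := ∑ k ∈ Finset.Icc N L, |a k - a (k + 1)| with hVdef
    have haN : a N ≤ V := by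
      have := Finset.sum_Ico_sub a (show N ≤ L + 1 by omega)
      rw [hL (L + 1) (by omega)] at this
      rw [hVdef, ← Finset.Ico_add_one_right_eq_Icc]
      calc a N = ∑ k ∈ Finset.Ico N (L + 1), -(a (k + 1) - a k) := by
            rw [Finset.sum_neg_distrib, this]; ring
        _ ≤ _ := Finset.sum_le_sum fun k _ => by rw [neg_sub]; exact le_abs_self _
    have habel := one_sub_mul_sum_Ico_mul_pow a z (show N ≤ L + 1 by omega)
    rw [hL (L + 1) (by omega)] at habel
    have hnorm : ‖1 - z‖ * ‖∑ k ∈ Finset.Ico N (L + 1), (a k : ℂ) * z ^ k‖ ≤ 2 * V := by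
      rw [← norm_mul, habel]
      refine (norm_add_le _ _).trans ?_
      have e1 : ‖(a N : ℂ) * z ^ N - ((0 : ℝ) : ℂ) * z ^ (L + 1)‖ = a N := by
        simp [hz1, abs_of_nonneg (ha.1 N)]
      have e2 : ‖∑ k ∈ Finset.Ico N (L + 1), ((a (k + 1) - a k : ℝ) : ℂ) * z ^ (k + 1)‖ ≤ V := by
        rw [hVdef, ← Finset.Ico_add_one_right_eq_Icc]
        refine (norm_sum_le _ _).trans (Finset.sum_le_sum fun k _ => ?_)
        rw [norm_mul, norm_pow, hz1, one_pow, mul_one, Complex.norm_real, Real.norm_eq_abs,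
          abs_sub_comm]
      linarith
    have hVT : V ≤ 4 * M * x * T := by
      refine hV.trans ?_
      have : ∑ m ∈ Finset.Icc 1 L with N ≤ 2 * m, a m / m ≤ 2 * x * T := by
        rw [hT, Finset.mul_sum]
        refine le_trans (Finset.sum_le_sum fun m hm => ?_)
          (Finset.sum_le_sum_of_subset_of_nonneg (Finset.filter_subset _ _) fun k _ _ =>
            mul_nonneg (by positivity) (hκ k))
        simp only [Finset.mem_Icc, Finset.mem_filter] at hm
        have hm0 : (0 : ℝ) < m := by exact_mod_cast hm.1.1
        have hmx : 1 / x < 2 * m := hNx.trans_le (by exact_mod_cast hm.2)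
        have hmin : 1 / (2 * (m * x)) ≤ min 1 (1 / ((m : ℝ) * x)) := by
          rw [div_lt_iff₀ hx0] at hmx
          refine le_min ?_ ?_
          · rw [div_le_one (by positivity)]; linarith
          · exact one_div_le_one_div_of_le (by positivity) (by nlinarith)
        calc a m / m = 2 * x * (1 / (2 * (m * x)) * a m) := by field_simp
          _ ≤ _ := by
            have := ha.1 m
            gcongr
      calc _ ≤ 2 * M * (2 * x * T) := by gcongr
        _ = _ := by ring
    set B := ‖∑ k ∈ Finset.Ico N (L + 1), (a k : ℂ) * z ^ k‖
    have h1 : 2 * x / Real.pi * B ≤ 2 * x / Real.pi * (4 * Real.pi * M * T) :=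
      calc _ ≤ ‖1 - z‖ * B := mul_le_mul_of_nonneg_right hz2 (norm_nonneg _)
        _ ≤ 2 * (4 * M * x * T) := by linarith
        _ = _ := by field_simp
    exact le_of_mul_le_mul_left h1 (by positivity)
  rw [← Finset.sum_filter_add_sum_filter_not _ (fun k => k < N)]
  refine (norm_add_le _ _).trans ?_
  linarith

lemma integral_min_mul_rpow {s c : ℝ} (hs0 : 0 < s) (hs1 : s < 1) (hc : 0 < c) :
    IntegrableOn (fun u : ℝ => min 1 (1 / (c * u)) * u ^ (s - 1)) (Set.Ioi 0) ∧
      ∫ u in Set.Ioi (0 : ℝ), min 1 (1 / (c * u)) * u ^ (s - 1) =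
        (1 / s + 1 / (1 - s)) * c ^ (-s) := by
  have hc' : 0 < 1 / c := by positivity
  have e1 : Set.EqOn (fun u : ℝ => u ^ (s - 1))
      (fun u : ℝ => min 1 (1 / (c * u)) * u ^ (s - 1)) (Set.Ioc 0 (1 / c)) := by
    intro u hu
    have hcu : 0 < c * u := mul_pos hc hu.1
    have : 1 ≤ 1 / (c * u) := by
      rw [le_div_iff₀ hcu]
      have := (le_div_iff₀ hc).1 hu.2
      linarith
    simp only [min_eq_left this, one_mul]
  have e2 : Set.EqOn (fun u : ℝ => c⁻¹ * u ^ (s - 2))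
      (fun u : ℝ => min 1 (1 / (c * u)) * u ^ (s - 1)) (Set.Ioi (1 / c)) := by
    intro u hu
    have hu0 : 0 < u := hc'.trans hu
    have hcu : 0 < c * u := mul_pos hc hu0
    have : 1 / (c * u) ≤ 1 := by
      rw [div_le_one hcu]
      have := (div_lt_iff₀ hc).1 hu
      linarith
    simp only [min_eq_right this]
    rw [show s - 2 = s - 1 - 1 by ring, Real.rpow_sub_one hu0.ne' (s - 1)]
    field_simp
  have i1 : IntegrableOn (fun u : ℝ => u ^ (s - 1)) (Set.Ioc 0 (1 / c)) :=
    (intervalIntegrable_iff_integrableOn_Ioc_of_le hc'.le).1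
      (intervalIntegral.intervalIntegrable_rpow' (by linarith))
  have i2 : IntegrableOn (fun u : ℝ => c⁻¹ * u ^ (s - 2)) (Set.Ioi (1 / c)) :=
    (integrableOn_Ioi_rpow_of_lt (by linarith) hc').const_mul _
  have i1' := i1.congr_fun e1 measurableSet_Ioc
  have i2' := i2.congr_fun e2 measurableSet_Ioi
  rw [← Set.Ioc_union_Ioi_eq_Ioi hc'.le]
  refine ⟨i1'.union i2', ?_⟩
  rw [setIntegral_union Set.Ioc_disjoint_Ioi_same measurableSet_Ioi i1' i2',
    ← setIntegral_congr_fun measurableSet_Ioc e1, ← setIntegral_congr_fun measurableSet_Ioi e2,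
    ← intervalIntegral.integral_of_le hc'.le, integral_rpow (Or.inl (by linarith)),
    integral_const_mul, integral_Ioi_rpow_of_lt (by linarith) hc']
  rw [show s - 1 + 1 = s by ring, show s - 2 + 1 = s - 1 by ring, Real.zero_rpow hs0.ne',
    one_div c, Real.rpow_sub_one (by positivity), Real.inv_rpow hc.le, ← Real.rpow_neg hc.le]
  have : s - 1 ≠ 0 := by linarith
  have : 1 - s ≠ 0 := by linarith
  field_simp
  ring

lemma sum_min_mul_rpow_le {s x : ℝ} (hs0 : 0 < s) (hs1 : s < 1) (hx : 0 < x) (L : ℕ) :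
    ∑ k ∈ Finset.Icc 1 L, min 1 (1 / ((k : ℝ) * x)) * (k : ℝ) ^ (s - 1) ≤
      (1 + (1 / s + 1 / (1 - s))) * x ^ (-s) := by
  have hs1' : 0 < 1 - s := by linarith
  rcases Nat.eq_zero_or_pos L with rfl | hL
  · simp only [Finset.Icc_eq_empty_of_lt Nat.zero_lt_one, Finset.sum_empty]
    positivity
  obtain ⟨hint, heq⟩ := integral_min_mul_rpow hs0 hs1 hx
  set g : ℝ → ℝ := fun u => min 1 (1 / (x * u)) * u ^ (s - 1) with hg
  have hg0 : ∀ u ∈ Set.Ioi (0 : ℝ), 0 ≤ g u := fun u hu => by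
    have hu' : 0 < u := hu
    exact mul_nonneg (le_min zero_le_one (by positivity)) (by positivity)
  have hanti : AntitoneOn g (Set.Icc ((1 : ℕ) : ℝ) (L : ℝ)) := by
    intro u hu v hv huv
    have hu0 : 0 < u := by have := hu.1; push_cast at this; linarith
    have hv0 : 0 < v := hu0.trans_le huv
    refine mul_le_mul (min_le_min le_rfl ?_) ?_ (by positivity)
      (le_min zero_le_one (by positivity))
    · exact one_div_le_one_div_of_le (by positivity) (by gcongr)
    · exact Real.rpow_le_rpow_of_nonpos hu0 huv (by linarith)
  have hsum := hanti.sum_le_integral_Ico (Nat.one_le_iff_ne_zero.2 hL.ne')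
  have hle : ∫ u in ((1 : ℕ) : ℝ)..(L : ℝ), g u ≤ ∫ u in Set.Ioi (0 : ℝ), g u := by
    rw [intervalIntegral.integral_of_le (by exact_mod_cast hL)]
    refine setIntegral_mono_set hint ?_ (Eventually.of_forall fun u hu => ?_)
    · exact (ae_restrict_iff' measurableSet_Ioi).2 (Eventually.of_forall hg0)
    · have h1 : ((1 : ℕ) : ℝ) < u := hu.1
      push_cast at h1
      exact zero_lt_one.trans h1
  have hg1 : g 1 ≤ x ^ (-s) := by
    simp only [hg, mul_one, Real.one_rpow]
    rcases le_total x 1 with h | h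
    · exact (min_le_left _ _).trans (Real.one_le_rpow_of_pos_of_le_one_of_nonpos hx h (by linarith))
    · refine (min_le_right _ _).trans ?_
      rw [one_div, ← Real.rpow_neg_one]
      exact Real.rpow_le_rpow_of_exponent_le h (by linarith)
  have hsplit : ∑ k ∈ Finset.Icc 1 L, min 1 (1 / ((k : ℝ) * x)) * (k : ℝ) ^ (s - 1) =
      g 1 + ∑ i ∈ Finset.Ico 1 L, g ((i + 1 : ℕ) : ℝ) := by
    rw [← Finset.Ico_add_one_right_eq_Icc, Finset.sum_eq_sum_Ico_succ_bot (by omega),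
      ← Finset.sum_Ico_add' (fun k : ℕ => min 1 (1 / ((k : ℝ) * x)) * (k : ℝ) ^ (s - 1)) 1 L 1]
    simp only [hg, Nat.cast_one, mul_comm x]
  rw [hsplit, add_mul, one_mul, ← heq]
  exact add_le_add hg1 (hsum.trans hle)

/-- Weighted Hardy-type inequality for the kernel `min 1 (1 / (k x))`, in pointwise form. -/
lemma sum_min_mul_rpow_pow_le {p x : ℝ} (hp : 1 < p) (hx : 0 < x) {a : ℕ → ℝ}
    (ha : ∀ n, 0 ≤ a n) (L : ℕ) :
    (∑ k ∈ Finset.Icc 1 L, min 1 (1 / ((k : ℝ) * x)) * a k) ^ p ≤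
      (1 + (1 / p⁻¹ + 1 / (1 - p⁻¹))) ^ (p - 1) *
        ∑ k ∈ Finset.Icc 1 L, (k : ℝ) ^ (p⁻¹ + p - 2) * a k ^ p *
          (min 1 (1 / ((k : ℝ) * x)) * x ^ (p⁻¹ - 1)) := by
  have hp0 : 0 < p := by linarith
  have hs0 : 0 < p⁻¹ := by positivity
  have hs1 : p⁻¹ < 1 := inv_lt_one_of_one_lt₀ hp
  set s := p⁻¹ with hs
  have hsp : s * p = 1 := inv_mul_cancel₀ hp0.ne'
  set D := 1 + (1 / s + 1 / (1 - s)) with hD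
  have hs1' : 0 < 1 - s := by linarith
  have hD0 : 0 < D := by positivity
  have hmin : ∀ k : ℕ, 0 ≤ min 1 (1 / ((k : ℝ) * x)) := fun k =>
    le_min zero_le_one (by positivity)
  have hold := Real.inner_le_weight_mul_Lp_of_nonneg (Finset.Icc 1 L) hp.le
    (fun k : ℕ => min 1 (1 / ((k : ℝ) * x)) * (k : ℝ) ^ (s - 1))
    (fun k : ℕ => a k * (k : ℝ) ^ (1 - s))
    (fun k => mul_nonneg (hmin k) (by positivity)) (fun k => mul_nonneg (ha k) (by positivity))
  have e1 : ∀ k ∈ Finset.Icc 1 L, min 1 (1 / ((k : ℝ) * x)) * (k : ℝ) ^ (s - 1) *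
      (a k * (k : ℝ) ^ (1 - s)) = min 1 (1 / ((k : ℝ) * x)) * a k := by
    intro k hk
    have hk0 : (0 : ℝ) < k := by exact_mod_cast (Finset.mem_Icc.1 hk).1
    have : (k : ℝ) ^ (s - 1) * (k : ℝ) ^ (1 - s) = 1 := by
      rw [← Real.rpow_add hk0]; simp
    linear_combination (min 1 (1 / ((k : ℝ) * x)) * a k) * this
  have e2 : ∀ k ∈ Finset.Icc 1 L, min 1 (1 / ((k : ℝ) * x)) * (k : ℝ) ^ (s - 1) *
      (a k * (k : ℝ) ^ (1 - s)) ^ p =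
        (k : ℝ) ^ (s + p - 2) * a k ^ p * min 1 (1 / ((k : ℝ) * x)) := by
    intro k hk
    have hk0 : (0 : ℝ) < k := by exact_mod_cast (Finset.mem_Icc.1 hk).1
    rw [Real.mul_rpow (ha k) (by positivity), ← Real.rpow_mul hk0.le]
    have : (k : ℝ) ^ (s + p - 2) = (k : ℝ) ^ (s - 1) * (k : ℝ) ^ ((1 - s) * p) := by
      rw [← Real.rpow_add hk0]; congr 1; linear_combination hsp
    rw [this]; ring
  rw [Finset.sum_congr rfl e1, Finset.sum_congr rfl e2] at hold
  set W := ∑ k ∈ Finset.Icc 1 L, min 1 (1 / ((k : ℝ) * x)) * (k : ℝ) ^ (s - 1)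
  set R := ∑ k ∈ Finset.Icc 1 L, (k : ℝ) ^ (s + p - 2) * a k ^ p * min 1 (1 / ((k : ℝ) * x))
    with hR
  have hW0 : 0 ≤ W := Finset.sum_nonneg fun k _ => mul_nonneg (hmin k) (by positivity)
  have hR0 : 0 ≤ R := Finset.sum_nonneg fun k _ =>
    mul_nonneg (mul_nonneg (by positivity) (Real.rpow_nonneg (ha k) _)) (hmin k)
  have hW : W ≤ D * x ^ (-s) := sum_min_mul_rpow_le hs0 hs1 hx L
  calc _ ≤ (W ^ (1 - s) * R ^ s) ^ p := by
        refine Real.rpow_le_rpow (Finset.sum_nonneg fun k _ => mul_nonneg (hmin k) (ha k)) ?_ hp0.le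
        simpa only [hs, inv_inv] using hold
    _ = W ^ (p - 1) * R := by
        rw [Real.mul_rpow (by positivity) (by positivity), ← Real.rpow_mul hW0,
          ← Real.rpow_mul hR0, hsp, Real.rpow_one, sub_mul, one_mul, hsp]
    _ ≤ (D * x ^ (-s)) ^ (p - 1) * R := by
        refine mul_le_mul_of_nonneg_right (Real.rpow_le_rpow hW0 hW (by linarith)) hR0
    _ = _ := by
        rw [Real.mul_rpow hD0.le (by positivity), ← Real.rpow_mul hx.le, mul_assoc, hR,
          Finset.mul_sum]
        congr 1
        refine Finset.sum_congr rfl fun k _ => ?_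
        rw [show -s * (p - 1) = s - 1 by linear_combination -hsp]
        ring

/-- Hardy–Littlewood type estimate for trigonometric polynomials with GBV coefficients. -/
theorem exists_integral_norm_trigPoly_le {p M : ℝ} (hp : 1 < p) (hM : 0 ≤ M) :
    ∃ C : ℝ, 0 < C ∧ ∀ (a : ℕ → ℝ) (L : ℕ), IsGBV M a → (∀ k, L < k → a k = 0) →
      ∫ x in (0 : ℝ)..2 * Real.pi,
          ‖∑ k ∈ Finset.Icc 1 L, (a k : ℂ) * Complex.exp (Complex.I * x) ^ k‖ ^ p ≤
        C * ∑ k ∈ Finset.Icc 1 L, (k : ℝ) ^ (p - 2) * a k ^ p := by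
  have hp0 : 0 < p := by linarith
  have hpi := Real.pi_pos
  have hs0 : 0 < p⁻¹ := by positivity
  have hs1 : p⁻¹ < 1 := inv_lt_one_of_one_lt₀ hp
  have hs1' : 0 < 1 - p⁻¹ := by linarith
  set J := 1 / p⁻¹ + 1 / (1 - p⁻¹) with hJ
  have hJ0 : 0 < J := by positivity
  set A := (1 + 4 * Real.pi * M) ^ p * (1 + J) ^ (p - 1) with hA
  have hA0 : 0 < A := by positivity
  refine ⟨2 * (A * J), by positivity, fun a L ha hL => ?_⟩
  set F : ℝ → ℝ := fun x =>
    ‖∑ k ∈ Finset.Icc 1 L, (a k : ℂ) * Complex.exp (Complex.I * x) ^ k‖ ^ p with hF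
  have hcont : Continuous F :=
    Continuous.rpow_const (by fun_prop) fun _ => Or.inr hp0.le
  have hrefl : ∀ x, F (2 * Real.pi - x) = F x := by
    intro x
    simp only [hF]
    congr 1
    rw [← Complex.norm_conj (∑ k ∈ Finset.Icc 1 L, (a k : ℂ) * Complex.exp (Complex.I * x) ^ k)]
    congr 1
    simp only [map_sum, map_mul, map_pow, Complex.conj_ofReal, ← Complex.exp_conj, Complex.conj_I]
    refine Finset.sum_congr rfl fun k _ => ?_
    congr 2
    push_cast
    rw [show Complex.I * (2 * Real.pi - x) = -Complex.I * x + 2 * Real.pi * Complex.I by ring,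
      Complex.exp_add, Complex.exp_two_pi_mul_I, mul_one]
  have hhalf : ∫ x in (0 : ℝ)..2 * Real.pi, F x = 2 * ∫ x in (0 : ℝ)..Real.pi, F x := by
    have := intervalIntegral.integral_comp_sub_left (a := 0) (b := Real.pi) F (2 * Real.pi)
    simp only [hrefl] at this
    rw [sub_zero, show 2 * Real.pi - Real.pi = Real.pi by ring] at this
    rw [← intervalIntegral.integral_add_adjacent_intervals (hcont.intervalIntegrable 0 Real.pi)
      (hcont.intervalIntegrable Real.pi (2 * Real.pi)), ← this]
    ring
  set κ : ℕ → ℝ → ℝ := fun k x => min 1 (1 / ((k : ℝ) * x)) * x ^ (p⁻¹ - 1) with hκ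
  set G : ℝ → ℝ := fun x => ∑ k ∈ Finset.Icc 1 L,
    A * ((k : ℝ) ^ (p⁻¹ + p - 2) * a k ^ p) * κ k x with hG
  have hκint : ∀ k ∈ Finset.Icc 1 L, IntegrableOn (κ k) (Set.Ioi 0) ∧
      ∫ x in Set.Ioi 0, κ k x = J * (k : ℝ) ^ (-p⁻¹) := fun k hk =>
    integral_min_mul_rpow hs0 hs1 (by exact_mod_cast (Finset.mem_Icc.1 hk).1)
  have hGint : IntegrableOn G (Set.Ioi 0) :=
    integrable_finsetSum _ fun k hk => (hκint k hk).1.const_mul _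
  have hG0 : ∀ x ∈ Set.Ioi (0 : ℝ), 0 ≤ G x := fun x hx => by
    have hx' : 0 < x := hx
    exact Finset.sum_nonneg fun k _ => mul_nonneg
      (mul_nonneg hA0.le (mul_nonneg (by positivity) (Real.rpow_nonneg (ha.1 k) _)))
      (mul_nonneg (le_min zero_le_one (by positivity)) (by positivity))
  have hFG : ∀ x ∈ Set.Ioc 0 Real.pi, F x ≤ G x := by
    intro x hx
    have hT0 : 0 ≤ ∑ k ∈ Finset.Icc 1 L, min 1 (1 / ((k : ℝ) * x)) * a k :=
      Finset.sum_nonneg fun k _ => mul_nonneg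
        (le_min zero_le_one (by have := hx.1; positivity)) (ha.1 k)
    calc F x ≤ ((1 + 4 * Real.pi * M) *
            ∑ k ∈ Finset.Icc 1 L, min 1 (1 / ((k : ℝ) * x)) * a k) ^ p :=
          Real.rpow_le_rpow (norm_nonneg _) (ha.norm_sum_mul_exp_le hM hL hx.1 hx.2) hp0.le
      _ = (1 + 4 * Real.pi * M) ^ p *
            (∑ k ∈ Finset.Icc 1 L, min 1 (1 / ((k : ℝ) * x)) * a k) ^ p :=
          Real.mul_rpow (by positivity) hT0
      _ ≤ _ := mul_le_mul_of_nonneg_left (sum_min_mul_rpow_pow_le hp hx.1 ha.1 L) (by positivity)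
      _ = G x := by
          rw [← mul_assoc, Finset.mul_sum]
          exact Finset.sum_congr rfl fun k _ => (mul_assoc _ _ _).symm
  rw [hhalf, mul_assoc]
  refine mul_le_mul_of_nonneg_left ?_ zero_le_two
  have hsub : Set.Ioc 0 Real.pi ⊆ Set.Ioi 0 := fun x hx => hx.1
  calc ∫ x in (0 : ℝ)..Real.pi, F x = ∫ x in Set.Ioc 0 Real.pi, F x :=
        intervalIntegral.integral_of_le hpi.le
    _ ≤ ∫ x in Set.Ioc 0 Real.pi, G x :=
        setIntegral_mono_on ((intervalIntegrable_iff_integrableOn_Ioc_of_le hpi.le).1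
          (hcont.intervalIntegrable _ _)) (hGint.mono_set hsub) measurableSet_Ioc hFG
    _ ≤ ∫ x in Set.Ioi 0, G x :=
        setIntegral_mono_set hGint
          ((ae_restrict_iff' measurableSet_Ioi).2 (Eventually.of_forall hG0))
          (Eventually.of_forall hsub)
    _ = ∑ k ∈ Finset.Icc 1 L, A * ((k : ℝ) ^ (p⁻¹ + p - 2) * a k ^ p) *
          ∫ x in Set.Ioi 0, κ k x := by
        rw [integral_finsetSum _ fun k hk => (hκint k hk).1.const_mul _]
        exact Finset.sum_congr rfl fun k _ => integral_const_mul _ _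
    _ = _ := by
        rw [Finset.mul_sum]
        refine Finset.sum_congr rfl fun k hk => ?_
        have hk0 : (0 : ℝ) < k := by exact_mod_cast (Finset.mem_Icc.1 hk).1
        rw [(hκint k hk).2, show p - 2 = (p⁻¹ + p - 2) + -p⁻¹ by ring, Real.rpow_add hk0]
        ring

lemma add_add_rpow_le {p x y z : ℝ} (hp : 0 ≤ p) (hx : 0 ≤ x) (hy : 0 ≤ y) (hz : 0 ≤ z) :
    (x + y + z) ^ p ≤ 3 ^ p * (x ^ p + y ^ p + z ^ p) := by
  have hx' := Real.rpow_nonneg hx p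
  have hy' := Real.rpow_nonneg hy p
  have hz' := Real.rpow_nonneg hz p
  have key : ∀ w, 0 ≤ w → x + y + z ≤ 3 * w → (x + y + z) ^ p ≤ 3 ^ p * w ^ p := fun w hw h => by
    rw [← Real.mul_rpow (by norm_num) hw]
    exact Real.rpow_le_rpow (by positivity) h hp
  have h3 : (0 : ℝ) ≤ 3 ^ p := by positivity
  rcases le_total x y with hxy | hxy <;> rcases le_total y z with hyz | hyz <;>
    rcases le_total x z with hxz | hxz
  all_goals first
    | exact (key x hx (by linarith)).trans (mul_le_mul_of_nonneg_left (by linarith) h3)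
    | exact (key y hy (by linarith)).trans (mul_le_mul_of_nonneg_left (by linarith) h3)
    | exact (key z hz (by linarith)).trans (mul_le_mul_of_nonneg_left (by linarith) h3)

lemma isGBV_min_one_div {n : ℕ} (hn : 1 ≤ n) :
    IsGBV 2 (fun k : ℕ => min 1 ((k : ℝ) / n)) := by
  have hn0 : (0 : ℝ) < n := by exact_mod_cast hn
  refine IsGBV.of_monotone (fun k => le_min zero_le_one (by positivity))
    (fun i j hij => min_le_min le_rfl (by gcongr)) fun m hm => ?_
  rcases le_total 1 ((m : ℝ) / n) with h | h
  · rw [min_eq_left h]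
    exact (min_le_left _ _).trans (by norm_num)
  · rw [min_eq_right h]
    refine (min_le_right _ _).trans ?_
    have hm1 : (1 : ℝ) ≤ m := by exact_mod_cast hm
    rw [mul_div_assoc']
    push_cast
    gcongr
    linarith

lemma isGBV_one_sub_min_one_div (n : ℕ) :
    IsGBV 1 (fun k : ℕ => 1 - min 1 ((k : ℝ) / n)) :=
  IsGBV.of_antitone (fun _ => sub_nonneg.2 (min_le_left _ _))
    fun _ _ hij => sub_le_sub_left (min_le_min le_rfl (by gcongr)) _

lemma isGBV_indicator_le (L : ℕ) : IsGBV 1 (fun k : ℕ => if k ≤ L then (1 : ℝ) else 0) := by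
  refine IsGBV.of_antitone (fun k => by positivity) fun i j hij => ?_
  split_ifs <;> first | omega | norm_num

lemma isGBV_sin_min {n : ℕ} {t : ℝ} (ht0 : 0 < t) (ht : n * t ≤ 1) :
    IsGBV 5 (fun k : ℕ => Real.sin ((min k n : ℕ) * (t / 2))) := by
  have hpi := Real.pi_gt_three
  have hle : ∀ k : ℕ, ((min k n : ℕ) : ℝ) * (t / 2) ≤ 1 / 2 := fun k => by
    have : ((min k n : ℕ) : ℝ) ≤ n := by exact_mod_cast min_le_right k n
    nlinarith
  have h0 : ∀ k : ℕ, 0 ≤ ((min k n : ℕ) : ℝ) * (t / 2) := fun k => by positivity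
  refine IsGBV.of_monotone
    (fun k => Real.sin_nonneg_of_nonneg_of_le_pi (h0 k) (by linarith [hle k])) (fun i j hij => ?_)
    fun m hm => ?_
  · refine Real.sin_le_sin_of_le_of_le_pi_div_two (by linarith [h0 i]) (by linarith [hle j]) ?_
    have : ((min i n : ℕ) : ℝ) ≤ (min j n : ℕ) := by exact_mod_cast min_le_min_right n hij
    gcongr
  · have h1 := Real.mul_le_sin (h0 m) (by linarith [hle m])
    have h2 := Real.sin_le (h0 (2 * m + 1))
    have h3 : ((min (2 * m + 1) n : ℕ) : ℝ) ≤ 3 * (min m n : ℕ) := by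
      have : min (2 * m + 1) n ≤ 3 * min m n := by omega
      exact_mod_cast this
    have h4 : 1 / 2 ≤ 2 / Real.pi := by
      rw [div_le_div_iff₀ (by norm_num) Real.pi_pos]
      linarith [Real.pi_le_four]
    have h5 := mul_le_mul_of_nonneg_right h4 (h0 m)
    nlinarith

lemma re_sum_mul_exp_pow (a : ℕ → ℝ) (s : Finset ℕ) (x : ℝ) :
    (∑ k ∈ s, (a k : ℂ) * Complex.exp (Complex.I * x) ^ k).re =
      ∑ k ∈ s, a k * Real.cos (k * x) := by
  rw [Complex.re_sum]
  refine Finset.sum_congr rfl fun k _ => ?_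
  rw [Complex.re_ofReal_mul, ← Complex.exp_nat_mul,
    show (k : ℂ) * (Complex.I * x) = ((k * x : ℝ) : ℂ) * Complex.I by push_cast; ring,
    Complex.exp_ofReal_mul_I_re]

lemma im_sum_mul_exp_pow (a : ℕ → ℝ) (s : Finset ℕ) (x : ℝ) :
    (∑ k ∈ s, (a k : ℂ) * Complex.exp (Complex.I * x) ^ k).im =
      ∑ k ∈ s, a k * Real.sin (k * x) := by
  rw [Complex.im_sum]
  refine Finset.sum_congr rfl fun k _ => ?_
  rw [Complex.im_ofReal_mul, ← Complex.exp_nat_mul,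
    show (k : ℂ) * (Complex.I * x) = ((k * x : ℝ) : ℂ) * Complex.I by push_cast; ring,
    Complex.exp_ofReal_mul_I_im]

/-- Modulus of continuity of the partial sums of a cosine series with GBV coefficients. -/
theorem exists_integral_cosPoly_translate_sub_le {p M : ℝ} (hp : 1 < p) (hM : 0 ≤ M) :
    ∃ C : ℝ, 0 < C ∧ ∀ (lam : ℕ → ℝ), IsGBV M lam → ∀ n : ℕ, 1 ≤ n → ∀ t : ℝ, 0 < t →
      n * t ≤ 1 → ∀ L : ℕ,
      ∫ x in (0 : ℝ)..2 * Real.pi,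
          |∑ k ∈ Finset.Icc 1 L, lam k * Real.cos (k * (x + t)) -
            ∑ k ∈ Finset.Icc 1 L, lam k * Real.cos (k * x)| ^ p ≤
        C * ∑ k ∈ Finset.Icc 1 L, (k : ℝ) ^ (p - 2) * (lam k * min 1 ((k : ℝ) / n)) ^ p := by
  have hp0 : 0 ≤ p := by linarith
  set Q : ℝ → ℝ → ℝ := fun M K => M * (1 + K) + (1 + M) * K with hQ
  have hQ0 : ∀ {M K : ℝ}, 0 ≤ M → 0 ≤ K → 0 ≤ Q M K := fun h h' => by positivity
  have hMa : 0 ≤ Q (Q M 2) 1 := hQ0 (hQ0 hM (by norm_num)) (by norm_num)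
  have hMb : 0 ≤ Q (Q (Q M 1) 5) 1 :=
    hQ0 (hQ0 (hQ0 hM (by norm_num)) (by norm_num)) (by norm_num)
  obtain ⟨Ca, hCa, hA⟩ := exists_integral_norm_trigPoly_le hp hMa
  obtain ⟨Cb, hCb, hB⟩ := exists_integral_norm_trigPoly_le hp hMb
  refine ⟨3 ^ p * (Ca + Ca + 2 ^ p * Cb), by positivity, fun lam hlam n hn t ht0 ht L => ?_⟩
  have hn0 : (0 : ℝ) < n := by exact_mod_cast hn
  set v : ℕ → ℝ := fun k => min 1 ((k : ℝ) / n) with hv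
  set a : ℕ → ℝ := fun k => lam k * v k * (if k ≤ L then 1 else 0) with ha_def
  set b : ℕ → ℝ := fun k =>
    lam k * (1 - v k) * Real.sin ((min k n : ℕ) * (t / 2)) * (if k ≤ L then 1 else 0) with hb_def
  have ha : IsGBV (Q (Q M 2) 1) a :=
    IsGBV.mul (hQ0 hM (by norm_num)) (hlam.mul hM (isGBV_min_one_div hn)) (isGBV_indicator_le L)
  have hb : IsGBV (Q (Q (Q M 1) 5) 1) b :=
    IsGBV.mul (hQ0 (hQ0 hM (by norm_num)) (by norm_num))
      (IsGBV.mul (hQ0 hM (by norm_num)) (hlam.mul hM (isGBV_one_sub_min_one_div n))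
        (isGBV_sin_min ht0 ht)) (isGBV_indicator_le L)
  have haL : ∀ k ∈ Finset.Icc 1 L, a k = lam k * v k := fun k hk => by
    simp [ha_def, (Finset.mem_Icc.1 hk).2]
  have hbL : ∀ k ∈ Finset.Icc 1 L,
      b k = lam k * (1 - v k) * Real.sin ((min k n : ℕ) * (t / 2)) := fun k hk => by
    simp [hb_def, (Finset.mem_Icc.1 hk).2]
  have hba : ∀ k ∈ Finset.Icc 1 L, b k ≤ a k := by
    intro k hk
    rw [haL k hk, hbL k hk, mul_assoc]
    refine mul_le_mul_of_nonneg_left ?_ (hlam.1 k)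
    have h0 : 0 ≤ v k := le_min zero_le_one (by positivity)
    have h1 : 0 ≤ 1 - v k := sub_nonneg.2 (min_le_left _ _)
    have h2 : ((min k n : ℕ) : ℝ) * (t / 2) ≤ v k := by
      have hnt : t ≤ 1 / n := by rw [le_div_iff₀ hn0]; linarith
      refine le_min ?_ ?_
      · have : ((min k n : ℕ) : ℝ) ≤ n := by exact_mod_cast min_le_right k n
        nlinarith
      · have : ((min k n : ℕ) : ℝ) ≤ k := by exact_mod_cast min_le_left k n
        calc ((min k n : ℕ) : ℝ) * (t / 2) ≤ k * (1 / n) :=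
              mul_le_mul this (by linarith) (by positivity) (by positivity)
          _ = _ := by ring
    have h3 := Real.sin_le (x := ((min k n : ℕ) : ℝ) * (t / 2)) (by positivity)
    nlinarith
  set W := ∑ k ∈ Finset.Icc 1 L, (k : ℝ) ^ (p - 2) * (lam k * v k) ^ p with hW
  have hWa : ∑ k ∈ Finset.Icc 1 L, (k : ℝ) ^ (p - 2) * a k ^ p = W :=
    Finset.sum_congr rfl fun k hk => by rw [haL k hk]
  have hWb : ∑ k ∈ Finset.Icc 1 L, (k : ℝ) ^ (p - 2) * b k ^ p ≤ W := by
    rw [← hWa]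
    exact Finset.sum_le_sum fun k hk => mul_le_mul_of_nonneg_left
      (Real.rpow_le_rpow (hb.1 k) (hba k hk) hp0) (by positivity)
  have hIa := hA a L ha fun k hk => by simp [ha_def, hk]
  have hIb := hB b L hb fun k hk => by simp [hb_def, hk]
  rw [hWa] at hIa
  replace hIb := hIb.trans (mul_le_mul_of_nonneg_left hWb hCb.le)
  set E : (ℕ → ℝ) → ℝ → ℂ := fun c x =>
    ∑ k ∈ Finset.Icc 1 L, (c k : ℂ) * Complex.exp (Complex.I * x) ^ k with hE
  have hEcont : ∀ c, Continuous fun x => ‖E c x‖ ^ p := fun c =>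
    Continuous.rpow_const (by fun_prop) fun _ => Or.inr hp0
  have hshift : ∀ c h, ∫ x in (0 : ℝ)..2 * Real.pi, ‖E c (x + h)‖ ^ p =
      ∫ x in (0 : ℝ)..2 * Real.pi, ‖E c x‖ ^ p := by
    intro c h
    have hper : Function.Periodic (fun x => ‖E c x‖ ^ p) (2 * Real.pi) := by
      intro x
      have : Complex.exp (Complex.I * ((x + 2 * Real.pi : ℝ) : ℂ)) =
          Complex.exp (Complex.I * x) := by
        push_cast
        rw [show Complex.I * (x + 2 * Real.pi) = Complex.I * x + 2 * Real.pi * Complex.I by ring,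
          Complex.exp_add, Complex.exp_two_pi_mul_I, mul_one]
      simp only [hE, this]
    rw [intervalIntegral.integral_comp_add_right (fun x => ‖E c x‖ ^ p) h, zero_add,
      add_comm (2 * Real.pi) h, hper.intervalIntegral_add_eq h 0, zero_add]
  have hpt : ∀ x, ∑ k ∈ Finset.Icc 1 L, lam k * Real.cos (k * (x + t)) -
      ∑ k ∈ Finset.Icc 1 L, lam k * Real.cos (k * x) =
        (E a (x + t)).re - (E a x).re - 2 * (E b (x + t / 2)).im := by
    intro x
    rw [hE]
    dsimp only
    rw [re_sum_mul_exp_pow, re_sum_mul_exp_pow, im_sum_mul_exp_pow, Finset.mul_sum,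
      ← Finset.sum_sub_distrib, ← Finset.sum_sub_distrib, ← Finset.sum_sub_distrib]
    refine Finset.sum_congr rfl fun k hk => ?_
    rw [haL k hk, hbL k hk]
    have hcos : Real.cos (k * (x + t)) - Real.cos (k * x) =
        -2 * Real.sin (k * (x + t / 2)) * Real.sin (k * (t / 2)) := by
      rw [Real.cos_sub_cos]
      congr 2 <;> [congr 1; skip] <;> ring_nf
    rcases le_total k n with hkn | hkn
    · rw [min_eq_left hkn]
      linear_combination lam k * (1 - v k) * hcos
    · have : v k = 1 := min_eq_left ((one_le_div hn0).2 (by exact_mod_cast hkn))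
      rw [this]
      ring
  have hbound : ∀ x, |∑ k ∈ Finset.Icc 1 L, lam k * Real.cos (k * (x + t)) -
      ∑ k ∈ Finset.Icc 1 L, lam k * Real.cos (k * x)| ^ p ≤
        3 ^ p * (‖E a (x + t)‖ ^ p + ‖E a x‖ ^ p + 2 ^ p * ‖E b (x + t / 2)‖ ^ p) := by
    intro x
    rw [hpt, ← Real.mul_rpow (by norm_num) (norm_nonneg _)]
    refine le_trans (Real.rpow_le_rpow (abs_nonneg _) ?_ hp0)
      (add_add_rpow_le hp0 (norm_nonneg _) (norm_nonneg _) (by positivity))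
    have h1 := abs_le.1 (Complex.abs_re_le_norm (E a (x + t)))
    have h2 := abs_le.1 (Complex.abs_re_le_norm (E a x))
    have h3 := abs_le.1 (Complex.abs_im_le_norm (E b (x + t / 2)))
    norm_cast at h1 h2 h3 ⊢
    exact abs_le.2 ⟨by linarith [h1.1, h2.2, h3.2], by linarith [h1.2, h2.1, h3.1]⟩
  have i1 : IntervalIntegrable (fun x => ‖E a (x + t)‖ ^ p) volume 0 (2 * Real.pi) :=
    ((hEcont a).comp (continuous_add_const t)).intervalIntegrable _ _
  have i2 : IntervalIntegrable (fun x => ‖E a x‖ ^ p) volume 0 (2 * Real.pi) :=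
    (hEcont a).intervalIntegrable _ _
  have i3 : IntervalIntegrable (fun x => ‖E b (x + t / 2)‖ ^ p) volume 0 (2 * Real.pi) :=
    ((hEcont b).comp (continuous_add_const (t / 2))).intervalIntegrable _ _
  calc _ ≤ ∫ x in (0 : ℝ)..2 * Real.pi,
        3 ^ p * (‖E a (x + t)‖ ^ p + ‖E a x‖ ^ p + 2 ^ p * ‖E b (x + t / 2)‖ ^ p) := by
        refine intervalIntegral.integral_mono_on (by positivity) ?_
          (((i1.add i2).add (i3.const_mul _)).const_mul _) fun x _ => hbound x
        exact (Continuous.rpow_const (by fun_prop) fun _ => Or.inr hp0).intervalIntegrable _ _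
    _ = 3 ^ p * ((∫ x in (0 : ℝ)..2 * Real.pi, ‖E a x‖ ^ p) +
          (∫ x in (0 : ℝ)..2 * Real.pi, ‖E a x‖ ^ p) +
          2 ^ p * ∫ x in (0 : ℝ)..2 * Real.pi, ‖E b x‖ ^ p) := by
        rw [intervalIntegral.integral_const_mul, intervalIntegral.integral_add (i1.add i2)
          (i3.const_mul _), intervalIntegral.integral_add i1 i2,
          intervalIntegral.integral_const_mul, hshift, hshift]
    _ ≤ 3 ^ p * (Ca * W + Ca * W + 2 ^ p * (Cb * W)) := by gcongr
    _ = _ := by ring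

lemma sum_mul_min_one_div_le {p : ℝ} {lam : ℕ → ℝ} (hnn : ∀ n, 0 ≤ lam n)
    (hsum : Summable (fun n : ℕ => ((n + 1 : ℕ) : ℝ) ^ (p - 2) * lam (n + 1) ^ p))
    {n : ℕ} (hn : 1 ≤ n) (L : ℕ) :
    ∑ k ∈ Finset.Icc 1 L, (k : ℝ) ^ (p - 2) * (lam k * min 1 ((k : ℝ) / n)) ^ p ≤
      (n : ℝ) ^ (-p) * ∑ k ∈ Finset.Icc 1 (n - 1), (k : ℝ) ^ (2 * p - 2) * lam k ^ p +
        ∑' k : ℕ, ((n + k : ℕ) : ℝ) ^ (p - 2) * lam (n + k) ^ p := by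
  have hn0 : (0 : ℝ) < n := by exact_mod_cast hn
  have hterm : ∀ (q : ℝ) (k : ℕ), 0 ≤ (k : ℝ) ^ q * lam k ^ p := fun q k =>
    mul_nonneg (by positivity) (Real.rpow_nonneg (hnn k) _)
  rw [← Finset.sum_filter_add_sum_filter_not _ (fun k => k < n)]
  refine add_le_add ?_ ?_
  · rw [Finset.mul_sum]
    calc _ = ∑ k ∈ Finset.Icc 1 L with k < n,
          (n : ℝ) ^ (-p) * ((k : ℝ) ^ (2 * p - 2) * lam k ^ p) := by
          refine Finset.sum_congr rfl fun k hk => ?_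
          simp only [Finset.mem_filter, Finset.mem_Icc] at hk
          have hk0 : (0 : ℝ) < k := by exact_mod_cast hk.1.1
          have hkn : (k : ℝ) / n ≤ 1 := (div_le_one hn0).2 (by exact_mod_cast hk.2.le)
          rw [min_eq_right hkn, Real.mul_rpow (hnn k) (by positivity),
            Real.div_rpow hk0.le hn0.le, Real.rpow_neg hn0.le,
            show 2 * p - 2 = (p - 2) + p by ring, Real.rpow_add hk0]
          ring
      _ ≤ _ := Finset.sum_le_sum_of_subset_of_nonneg
          (fun k hk => by simp only [Finset.mem_filter, Finset.mem_Icc] at *; omega)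
          fun k _ _ => mul_nonneg (by positivity) (hterm _ k)
  · have hset : (Finset.Icc 1 L).filter (fun k => ¬ k < n) = Finset.Ico n (L + 1) := by
      ext k; simp only [Finset.mem_Icc, Finset.mem_filter, Finset.mem_Ico]; omega
    have hsum' : Summable fun k : ℕ => ((n + k : ℕ) : ℝ) ^ (p - 2) * lam (n + k) ^ p := by
      refine ((summable_nat_add_iff (n - 1)).2 hsum).congr fun k => ?_
      rw [show k + (n - 1) + 1 = n + k by omega]
    rw [hset]
    calc _ = ∑ k ∈ Finset.Ico n (L + 1), (k : ℝ) ^ (p - 2) * lam k ^ p := by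
          refine Finset.sum_congr rfl fun k hk => ?_
          rw [min_eq_left ((one_le_div hn0).2 (by exact_mod_cast (Finset.mem_Ico.1 hk).1)),
            mul_one]
      _ ≤ _ := by
          rw [Finset.sum_Ico_eq_sum_range]
          exact hsum'.sum_le_tsum _ fun k _ => hterm _ _

/-- Fatou's lemma for the Bochner integral, with a uniform bound on the integrals; the limit need
not be integrable. -/
lemma integral_le_of_ae_tendsto {α : Type*} [MeasurableSpace α] {μ : Measure α}
    {F : ℕ → α → ℝ} {g : α → ℝ} {B : ℝ} (hB : 0 ≤ B) (hFm : ∀ L, Measurable (F L))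
    (hF : ∀ L, Integrable (F L) μ) (hF0 : ∀ L x, 0 ≤ F L x) (hg0 : ∀ x, 0 ≤ g x)
    (hle : ∀ L, ∫ x, F L x ∂μ ≤ B)
    (hlim : ∀ᵐ x ∂μ, Tendsto (fun L => F L x) atTop (nhds (g x))) :
    ∫ x, g x ∂μ ≤ B := by
  by_cases hg : Integrable g μ
  · rw [← ENNReal.ofReal_le_ofReal_iff hB,
      ofReal_integral_eq_lintegral_ofReal hg (Eventually.of_forall hg0)]
    calc ∫⁻ x, ENNReal.ofReal (g x) ∂μ
        = ∫⁻ x, liminf (fun L => ENNReal.ofReal (F L x)) atTop ∂μ := by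
          refine lintegral_congr_ae ?_
          filter_upwards [hlim] with x hx
          exact (ENNReal.tendsto_ofReal hx).liminf_eq.symm
      _ ≤ liminf (fun L => ∫⁻ x, ENNReal.ofReal (F L x) ∂μ) atTop :=
          lintegral_liminf_le fun L => (hFm L).ennreal_ofReal
      _ ≤ liminf (fun _ : ℕ => ENNReal.ofReal B) atTop := by
          refine liminf_le_liminf (Eventually.of_forall fun L => ?_)
          rw [← ofReal_integral_eq_lintegral_ofReal (hF L) (Eventually.of_forall (hF0 L))]
          exact ENNReal.ofReal_le_ofReal (hle L)
      _ = _ := liminf_const _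
  · rwa [integral_undef hg]

/-- Theorem 2.3: `L^p` modulus-of-continuity estimate for cosine series with
GBV coefficients. -/
theorem stmt_2 (p : ℝ) (hp1 : 1 < p)
    (lam : ℕ → ℝ) (hnn : ∀ n, 0 ≤ lam n) (hlim : Tendsto lam atTop (nhds 0))
    (hGBV : ∃ M : ℝ, 0 < M ∧ ∀ m : ℕ, 1 ≤ m →
      ∑ n ∈ Finset.Icc m (2 * m), |lam n - lam (n + 1)| ≤ M * lam m)
    (hsum : Summable (fun n : ℕ => ((n + 1 : ℕ) : ℝ) ^ (p - 2) * lam (n + 1) ^ p))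
    (f : ℝ → ℝ) (hper : Function.Periodic f (2 * Real.pi))
    (hf : ∀ x : ℝ, (∀ k : ℤ, x ≠ 2 * Real.pi * k) →
      Tendsto (fun N : ℕ => ∑ k ∈ Finset.Icc 1 N, lam k * Real.cos (k * x))
        atTop (nhds (f x))) :
    ∃ C : ℝ, 0 < C ∧ ∀ n : ℕ, 1 ≤ n → ∀ t : ℝ, 0 < t → t ≤ 1 / n →
      (∫ x in Set.Ioo (0 : ℝ) (2 * Real.pi), |f (x + t) - f x| ^ p) ^ (1 / p) ≤
        C * (n : ℝ)⁻¹ *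
            (∑ k ∈ Finset.Icc 1 (n - 1), (k : ℝ) ^ (2 * p - 2) * lam k ^ p) ^ (1 / p) +
          C * (∑' k : ℕ, ((n + k : ℕ) : ℝ) ^ (p - 2) * lam (n + k) ^ p) ^ (1 / p) := by
  obtain ⟨M, hM, hGBV⟩ := hGBV
  have hp0 : 0 < p := by linarith
  have hpi := Real.pi_pos
  obtain ⟨C, hC, hmain⟩ := exists_integral_cosPoly_translate_sub_le hp1 hM.le
  refine ⟨C ^ (1 / p), by positivity, fun n hn t ht0 ht => ?_⟩
  have hn0 : (0 : ℝ) < n := by exact_mod_cast hn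
  have hnt : n * t ≤ 1 := by
    rw [le_div_iff₀ hn0] at ht
    linarith
  set A := ∑ k ∈ Finset.Icc 1 (n - 1), (k : ℝ) ^ (2 * p - 2) * lam k ^ p with hA
  set R := ∑' k : ℕ, ((n + k : ℕ) : ℝ) ^ (p - 2) * lam (n + k) ^ p with hR
  have hA0 : 0 ≤ A := Finset.sum_nonneg fun k _ =>
    mul_nonneg (by positivity) (Real.rpow_nonneg (hnn k) _)
  have hR0 : 0 ≤ R := tsum_nonneg fun k =>
    mul_nonneg (by positivity) (Real.rpow_nonneg (hnn _) _)
  set S : ℕ → ℝ → ℝ := fun L x => ∑ k ∈ Finset.Icc 1 L, lam k * Real.cos (k * x) with hS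
  have hcont : ∀ L, Continuous fun x => |S L (x + t) - S L x| ^ p := fun L =>
    Continuous.rpow_const (by fun_prop) fun _ => Or.inr hp0.le
  have hae : ∀ᵐ x ∂(volume.restrict (Set.Ioo (0 : ℝ) (2 * Real.pi))),
      Tendsto (fun L => |S L (x + t) - S L x| ^ p) atTop (nhds (|f (x + t) - f x| ^ p)) := by
    refine ae_restrict_of_ae ?_
    have h1 : ∀ᵐ x : ℝ, x ∉ Set.range (fun k : ℤ => 2 * Real.pi * k) :=
      (Set.countable_range _).ae_notMem _
    have h2 : ∀ᵐ x : ℝ, x ∉ Set.range (fun k : ℤ => 2 * Real.pi * k - t) :=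
      (Set.countable_range _).ae_notMem _
    filter_upwards [h1, h2] with x hx1 hx2
    refine Tendsto.rpow_const (Tendsto.abs (Tendsto.sub (hf _ fun k hk => hx2 ⟨k, ?_⟩)
      (hf _ fun k hk => hx1 ⟨k, hk.symm⟩))) (Or.inr hp0.le)
    linarith
  have hint : ∫ x in Set.Ioo (0 : ℝ) (2 * Real.pi), |f (x + t) - f x| ^ p ≤
      C * ((n : ℝ) ^ (-p) * A + R) := by
    refine integral_le_of_ae_tendsto (by positivity) (fun L => (hcont L).measurable)
      (fun L => ((hcont L).integrableOn_Icc).mono_set Set.Ioo_subset_Icc_self)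
      (fun L x => by positivity) (fun x => by positivity) (fun L => ?_) hae
    rw [← integral_Ioc_eq_integral_Ioo, ← intervalIntegral.integral_of_le (by positivity)]
    exact (hmain lam ⟨hnn, hGBV⟩ n hn t ht0 hnt L).trans
      (mul_le_mul_of_nonneg_left (sum_mul_min_one_div_le hnn hsum hn L) hC.le)
  calc _ ≤ (C * ((n : ℝ) ^ (-p) * A + R)) ^ (1 / p) :=
        Real.rpow_le_rpow (integral_nonneg fun x => by positivity) hint (by positivity)
    _ = C ^ (1 / p) * ((n : ℝ) ^ (-p) * A + R) ^ (1 / p) :=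
        Real.mul_rpow hC.le (by positivity)
    _ ≤ C ^ (1 / p) * (((n : ℝ) ^ (-p) * A) ^ (1 / p) + R ^ (1 / p)) := by
        refine mul_le_mul_of_nonneg_left ?_ (by positivity)
        exact Real.rpow_add_le_add_rpow (by positivity) hR0 (by positivity)
          ((div_le_one hp0).2 hp1.le)
    _ = _ := by
        rw [Real.mul_rpow (by positivity) hA0, ← Real.rpow_mul hn0.le,
          show -p * (1 / p) = -1 by field_simp, Real.rpow_neg_one]
        ring
end

section
/- There exists a nonnegative sequence λ = (λ_n)_{n≥1} tending to zero which belongs to the class GBV but does not belong to the class R₀⁺BV, and which satisfies ∑_{n=1}^∞ n^{p+pγ−2} λ_n^p < ∞ for every p with 1 < p < ∞ and every γ with 1/p − 1 < γ < 1/p. -/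
open Filter

/-- The least number of the form `2 ^ 2 ^ (k + 1)` exceeding `n`. -/
def doubleExpAbove (n : ℕ) : ℕ := 2 ^ 2 ^ (Nat.log 2 (Nat.log 2 n) + 1)

theorem doubleExpAbove_pos (n : ℕ) : 0 < doubleExpAbove n := by
  unfold doubleExpAbove; positivity

theorem doubleExpAbove_mono : Monotone doubleExpAbove := by
  intro a b h
  unfold doubleExpAbove
  gcongr <;> norm_num

theorem lt_doubleExpAbove (n : ℕ) : n < doubleExpAbove n :=
  Nat.lt_pow_of_log_lt one_lt_two (Nat.lt_pow_succ_log_self one_lt_two _)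

theorem doubleExpAbove_two_pow {k j : ℕ} (h₁ : 2 ^ k ≤ j) (h₂ : j < 2 ^ (k + 1)) :
    doubleExpAbove (2 ^ j) = 2 ^ 2 ^ (k + 1) := by
  unfold doubleExpAbove
  rw [Nat.log_pow one_lt_two, Nat.log_eq_of_pow_le_of_lt_pow h₁ h₂]

/-- A sequence of the form `n * c n` with `c` nonnegative and antitone is in GBV. -/
theorem sum_Icc_abs_sub_le_of_antitone {c : ℕ → ℝ} (h0 : ∀ n, 0 ≤ c n) (hc : Antitone c)
    {m : ℕ} (hm : 1 ≤ m) :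
    ∑ n ∈ Finset.Icc m (2 * m), |n * c n - (n + 1 : ℕ) * c (n + 1)| ≤ 4 * (m * c m) := by
  have hm' : (1 : ℝ) ≤ m := by exact_mod_cast hm
  have hterm : ∀ n ∈ Finset.Icc m (2 * m), |n * c n - (n + 1 : ℕ) * c (n + 1)| ≤
      2 * m * (c n - c (n + 1)) + c m := by
    intro n hn
    rw [Finset.mem_Icc] at hn
    have h₁ : (n : ℝ) ≤ 2 * m := by exact_mod_cast hn.2
    have h₂ : c (n + 1) ≤ c n := hc n.le_succ
    have h₃ : c (n + 1) ≤ c m := hc (by omega)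
    have h₄ := h0 (n + 1)
    have h₅ : (n : ℝ) * (c n - c (n + 1)) ≤ 2 * m * (c n - c (n + 1)) :=
      mul_le_mul_of_nonneg_right h₁ (sub_nonneg.2 h₂)
    have h₆ : 0 ≤ (n : ℝ) * (c n - c (n + 1)) := mul_nonneg n.cast_nonneg (sub_nonneg.2 h₂)
    push_cast
    rw [abs_le]
    constructor <;> linarith
  refine (Finset.sum_le_sum hterm).trans ?_
  have htel : ∑ n ∈ Finset.Icc m (2 * m), (c n - c (n + 1)) = c m - c (2 * m + 1) := by
    rw [← Finset.Ico_add_one_right_eq_Icc]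
    have := Finset.sum_Ico_sub c (show m ≤ 2 * m + 1 by omega)
    rw [← neg_sub (c (2 * m + 1)), ← this, ← Finset.sum_neg_distrib]
    simp
  have hcard : 2 * m + 1 - m = m + 1 := by omega
  rw [Finset.sum_add_distrib, ← Finset.mul_sum, htel, Finset.sum_const, Nat.card_Icc, hcard,
    nsmul_eq_mul]
  push_cast
  nlinarith [h0 (2 * m + 1), h0 m, mul_nonneg (by linarith : (0 : ℝ) ≤ m) (h0 (2 * m + 1)),
    mul_nonneg (by linarith : (0 : ℝ) ≤ m - 1) (h0 m)]

theorem ofReal_abs_sub_le_tsum (f : ℕ → ℝ) (m d : ℕ) :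
    ENNReal.ofReal |f m - f (m + d)| ≤
      ∑' n : ℕ, ENNReal.ofReal |f (m + n) - f (m + n + 1)| := by
  refine le_trans ?_ (ENNReal.sum_le_tsum (Finset.range d))
  rw [← ENNReal.ofReal_sum_of_nonneg fun _ _ => abs_nonneg _]
  exact ENNReal.ofReal_le_ofReal (dist_le_range_sum_dist (fun n => f (m + n)) d)

/-- A nonnegative `O(1 / n)` sequence satisfies the weighted `ℓ^p` condition. -/
theorem summable_rpow_mul_rpow_of_le_inv {f : ℕ → ℝ} (h0 : ∀ n, 0 ≤ f n)
    (h : ∀ n, f n ≤ (n : ℝ)⁻¹) {p γ : ℝ} (hp : 0 < p) (hγ : γ < 1 / p) :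
    Summable (fun n : ℕ => ((n + 1 : ℕ) : ℝ) ^ (p + p * γ - 2) * f (n + 1) ^ p) := by
  have hpγ : p * γ < 1 := by
    rw [lt_div_iff₀ hp] at hγ; linarith
  have hs : Summable fun n : ℕ => ((n + 1 : ℕ) : ℝ) ^ (p * γ - 2) :=
    (summable_nat_add_iff 1).2 (Real.summable_nat_rpow.2 (by linarith))
  refine hs.of_nonneg_of_le (fun n => mul_nonneg (by positivity) (Real.rpow_nonneg (h0 _) _))
    fun n => ?_
  have hx : (0 : ℝ) < (n + 1 : ℕ) := by positivity
  calc ((n + 1 : ℕ) : ℝ) ^ (p + p * γ - 2) * f (n + 1) ^ p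
      ≤ ((n + 1 : ℕ) : ℝ) ^ (p + p * γ - 2) * (((n + 1 : ℕ) : ℝ)⁻¹) ^ p :=
        mul_le_mul_of_nonneg_left (Real.rpow_le_rpow (h0 _) (h _) hp.le) (by positivity)
    _ = ((n + 1 : ℕ) : ℝ) ^ (p * γ - 2) := by
        rw [Real.inv_rpow hx.le, ← Real.rpow_neg hx.le, ← Real.rpow_add hx]
        ring_nf

/-- Theorem 3: there is a nonnegative null sequence in GBV, not in R₀⁺BV, with
`∑ n^{p+pγ-2} λ_n^p < ∞` for all admissible `p, γ`. -/
theorem stmt_3 :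
    ∃ lam : ℕ → ℝ,
      (∀ n, 0 ≤ lam n) ∧ Tendsto lam atTop (nhds 0) ∧
      (∃ M : ℝ, 0 < M ∧ ∀ m : ℕ, 1 ≤ m →
        ∑ n ∈ Finset.Icc m (2 * m), |lam n - lam (n + 1)| ≤ M * lam m) ∧
      ¬ (∃ M : ℝ, 0 < M ∧ ∀ m : ℕ, 1 ≤ m →
        ∑' n : ℕ, ENNReal.ofReal |lam (m + n) - lam (m + n + 1)| ≤
          ENNReal.ofReal (M * lam m)) ∧
      (∀ p γ : ℝ, 1 < p → 1 / p - 1 < γ → γ < 1 / p →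
        Summable (fun n : ℕ => ((n + 1 : ℕ) : ℝ) ^ (p + p * γ - 2) * lam (n + 1) ^ p)) := by
  let c : ℕ → ℝ := fun n => ((doubleExpAbove n : ℝ) ^ 2)⁻¹
  have hg (n : ℕ) : (0 : ℝ) < doubleExpAbove n := by exact_mod_cast doubleExpAbove_pos n
  have hcpos (n : ℕ) : 0 < c n := inv_pos.2 (pow_pos (hg n) 2)
  have hc : Antitone c := fun a b hab =>
    inv_anti₀ (pow_pos (hg a) 2)
      (pow_le_pow_left₀ (hg a).le (by exact_mod_cast doubleExpAbove_mono hab) 2)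
  have h0 (n : ℕ) : 0 ≤ n * c n := mul_nonneg n.cast_nonneg (hcpos n).le
  have hle (n : ℕ) : n * c n ≤ (n : ℝ)⁻¹ := by
    rcases n.eq_zero_or_pos with rfl | hn
    · simp
    have hn' : (0 : ℝ) < n := by exact_mod_cast hn
    have hlt : (n : ℝ) ≤ doubleExpAbove n := by exact_mod_cast (lt_doubleExpAbove n).le
    calc n * c n ≤ n * ((n : ℝ) ^ 2)⁻¹ := by
          refine mul_le_mul_of_nonneg_left (inv_anti₀ (by positivity) ?_) hn'.le
          exact pow_le_pow_left₀ hn'.le hlt 2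
      _ = (n : ℝ)⁻¹ := by field_simp
  refine ⟨fun n => n * c n, h0, squeeze_zero h0 hle tendsto_inv_atTop_nhds_zero_nat,
    ⟨4, by norm_num, fun m hm => sum_Icc_abs_sub_le_of_antitone (fun n => (hcpos n).le) hc hm⟩,
    ?_, fun p γ hp _ hγ => summable_rpow_mul_rpow_of_le_inv h0 hle (by linarith) hγ⟩
  rintro ⟨M, hM, h⟩
  obtain ⟨k, hk⟩ := exists_nat_gt (M + 1)
  have hkpow : k + 1 ≤ 2 ^ k := Nat.lt_two_pow_self
  have hsucc : 2 ^ (k + 1) = 2 * 2 ^ k := pow_succ' 2 k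
  have hck : c (2 ^ (2 ^ k + k)) = c (2 ^ 2 ^ k) := by
    simp only [c]
    rw [doubleExpAbove_two_pow (k := k) (by omega) (by omega),
      doubleExpAbove_two_pow (k := k) le_rfl (by omega)]
  have hmono : 2 ^ 2 ^ k ≤ 2 ^ (2 ^ k + k) := Nat.pow_le_pow_right two_pos (by omega)
  have key := (ofReal_abs_sub_le_tsum (fun n => n * c n) (2 ^ 2 ^ k)
    (2 ^ (2 ^ k + k) - 2 ^ 2 ^ k)).trans (h _ Nat.one_le_two_pow)
  rw [ENNReal.ofReal_le_ofReal_iff (mul_nonneg hM.le (h0 _)),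
    Nat.add_sub_cancel' hmono, hck] at key
  have hpos : (0 : ℝ) < ((2 ^ 2 ^ k : ℕ) : ℝ) * c (2 ^ 2 ^ k) :=
    mul_pos (by positivity) (hcpos _)
  have hfac : ((2 ^ (2 ^ k + k) : ℕ) : ℝ) = 2 ^ k * ((2 ^ 2 ^ k : ℕ) : ℝ) := by
    push_cast; ring
  rw [hfac, mul_assoc] at key
  have hlow : (k : ℝ) < 2 ^ k := by exact_mod_cast Nat.lt_two_pow_self
  nlinarith [neg_abs_le (((2 ^ 2 ^ k : ℕ) : ℝ) * c (2 ^ 2 ^ k) -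
    2 ^ k * (((2 ^ 2 ^ k : ℕ) : ℝ) * c (2 ^ 2 ^ k)))]
end

section
/- Let λ = (λ_n)_{n≥1} be a nonnegative sequence in the class GBV. Then there is a constant C > 0 (depending only on λ) such that for every n ≥ 1, ∑_{j=1}^∞ λ_{2^j n} ≤ C ∑_{k=n}^∞ k^{−1} λ_k. -/
open Filter

/-- Under the GBV condition, a term is controlled by every term at index at least half its own. -/
lemma le_mul_of_sum_abs_sub_le {lam : ℕ → ℝ} {M : ℝ}
    (hM : ∀ m : ℕ, 1 ≤ m → ∑ n ∈ Finset.Icc m (2 * m), |lam n - lam (n + 1)| ≤ M * lam m)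
    {k l : ℕ} (hk : 1 ≤ k) (hkl : k ≤ l) (hlk : l ≤ 2 * k) :
    lam l ≤ (1 + M) * lam k := by
  have hdist := dist_le_Ico_sum_dist lam hkl
  simp only [Real.dist_eq] at hdist
  have hsub : ∑ i ∈ Finset.Ico k l, |lam i - lam (i + 1)| ≤
      ∑ i ∈ Finset.Icc k (2 * k), |lam i - lam (i + 1)| := by
    refine Finset.sum_le_sum_of_subset_of_nonneg (fun i hi => ?_) fun _ _ _ => abs_nonneg _
    simp only [Finset.mem_Ico, Finset.mem_Icc] at hi ⊢
    omega
  linarith [hM k hk, neg_abs_le (lam k - lam l)]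

/-- Under the GBV condition, `lam (2 * m)` is controlled by the sum of `k⁻¹ * lam k` over the
dyadic block `[m, 2 * m)`. -/
lemma le_mul_sum_Ico_inv_mul {lam : ℕ → ℝ} {M : ℝ} (hM0 : 0 < M) (hnn : ∀ n, 0 ≤ lam n)
    (hM : ∀ m : ℕ, 1 ≤ m → ∑ n ∈ Finset.Icc m (2 * m), |lam n - lam (n + 1)| ≤ M * lam m)
    {m : ℕ} (hm : 1 ≤ m) :
    lam (2 * m) ≤ 2 * (1 + M) * ∑ k ∈ Finset.Ico m (2 * m), (k : ℝ)⁻¹ * lam k := by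
  have hm' : (0 : ℝ) < m := by exact_mod_cast hm
  have hterm : ∀ k ∈ Finset.Ico m (2 * m),
      (2 * m : ℝ)⁻¹ * (lam (2 * m) / (1 + M)) ≤ (k : ℝ)⁻¹ * lam k := by
    intro k hk
    obtain ⟨hmk, hkm⟩ := Finset.mem_Ico.mp hk
    have hk0 : (0 : ℝ) < k := by exact_mod_cast hm.trans hmk
    have hle : (k : ℝ) ≤ 2 * m := by exact_mod_cast hkm.le
    have hlam : lam (2 * m) / (1 + M) ≤ lam k := by
      rw [div_le_iff₀' (by linarith)]
      exact le_mul_of_sum_abs_sub_le hM (hm.trans hmk) hkm.le (by omega)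
    have := hnn k
    have := hnn (2 * m)
    gcongr
  have hsum := Finset.card_nsmul_le_sum _ _ _ hterm
  rw [Nat.card_Ico, show 2 * m - m = m by omega, nsmul_eq_mul] at hsum
  calc lam (2 * m) = 2 * (1 + M) * (m * ((2 * m : ℝ)⁻¹ * (lam (2 * m) / (1 + M)))) := by
        have : 1 + M ≠ 0 := by positivity
        field_simp
    _ ≤ _ := by gcongr

/-- Lemma 3: for `λ ∈ GBV`, `∑_{j≥1} λ_{2^j n} ≤ C ∑_{k≥n} k⁻¹ λ_k`. -/
theorem stmt_4 (lam : ℕ → ℝ) (hnn : ∀ n, 0 ≤ lam n) (hlim : Tendsto lam atTop (nhds 0))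
    (hGBV : ∃ M : ℝ, 0 < M ∧ ∀ m : ℕ, 1 ≤ m →
      ∑ n ∈ Finset.Icc m (2 * m), |lam n - lam (n + 1)| ≤ M * lam m) :
    ∃ C : ℝ, 0 < C ∧ ∀ n : ℕ, 1 ≤ n →
      ∑' j : ℕ, ENNReal.ofReal (lam (2 ^ (j + 1) * n)) ≤
        ENNReal.ofReal C *
          ∑' k : ℕ, ENNReal.ofReal (((n + k : ℕ) : ℝ)⁻¹ * lam (n + k)) := by
  obtain ⟨M, hM0, hM⟩ := hGBV
  refine ⟨2 * (1 + M), by positivity, fun n hn => ENNReal.tsum_le_of_sum_range_le fun J => ?_⟩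
  have hpos : ∀ k : ℕ, 0 ≤ (k : ℝ)⁻¹ * lam k := fun k => mul_nonneg (by positivity) (hnn k)
  have hreal : ∑ j ∈ Finset.range J, lam (2 ^ (j + 1) * n) ≤
      2 * (1 + M) * ∑ k ∈ Finset.Ico n (2 ^ J * n), (k : ℝ)⁻¹ * lam k := by
    induction J with
    | zero => simp
    | succ J ih =>
      have hpow : 1 ≤ 2 ^ J := Nat.one_le_two_pow
      have hblock := le_mul_sum_Ico_inv_mul hM0 hnn hM (m := 2 ^ J * n) (Nat.mul_pos hpow hn)
      rw [show 2 * (2 ^ J * n) = 2 ^ (J + 1) * n by ring] at hblock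
      rw [Finset.sum_range_succ, ← Finset.sum_Ico_consecutive _ (Nat.le_mul_of_pos_left n hpow)
        (Nat.mul_le_mul_right n (Nat.pow_le_pow_right two_pos J.le_succ)), mul_add]
      exact add_le_add ih hblock
  rw [← ENNReal.ofReal_sum_of_nonneg fun _ _ => hnn _]
  calc ENNReal.ofReal (∑ j ∈ Finset.range J, lam (2 ^ (j + 1) * n))
      ≤ ENNReal.ofReal (2 * (1 + M) * ∑ k ∈ Finset.Ico n (2 ^ J * n), (k : ℝ)⁻¹ * lam k) :=
        ENNReal.ofReal_le_ofReal hreal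
    _ = ENNReal.ofReal (2 * (1 + M)) * ∑ k ∈ Finset.range (2 ^ J * n - n),
          ENNReal.ofReal (((n + k : ℕ) : ℝ)⁻¹ * lam (n + k)) := by
        rw [ENNReal.ofReal_mul (by positivity), Finset.sum_Ico_eq_sum_range,
          ENNReal.ofReal_sum_of_nonneg fun _ _ => hpos _]
    _ ≤ _ := by
        gcongr
        exact ENNReal.sum_le_tsum _
end

section
/- Let p ≥ 1, let (α_n)_{n≥1} be a sequence of nonnegative real numbers, and let (μ_n)_{n≥1} be a sequence of positive real numbers. Then ∑_{n=1}^∞ μ_n ( ∑_{k=1}^n α_k )^p ≤ p^p ∑_{n=1}^∞ μ_n^{1−p} ( ∑_{k=n}^∞ μ_k )^p α_n^p, where both sides are interpreted in the extended nonnegative reals (the inequality holding trivially if the right-hand side is infinite). -/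
/-- The graph of `t ↦ t ^ p` lies above its tangent line at `a`. -/
theorem rpow_tangent_le {p a y : ℝ} (hp : 1 ≤ p) (ha : 0 ≤ a) (hy : 0 ≤ y) :
    p * y * a ^ (p - 1) ≤ y ^ p + (p - 1) * a ^ p := by
  rcases ha.eq_or_lt with rfl | ha
  · rcases hp.eq_or_lt with rfl | hp
    · simp
    · rw [Real.zero_rpow (by linarith), Real.zero_rpow (by linarith)]
      simpa using Real.rpow_nonneg hy p
  · have h := one_add_mul_self_le_rpow_one_add (s := y / a - 1)
      (by linarith [div_nonneg hy ha.le]) hp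
    rw [add_sub_cancel, Real.div_rpow hy ha.le, le_div_iff₀ (Real.rpow_pos_of_pos ha p)] at h
    have e : y / a * a ^ p = y * a ^ (p - 1) := by
      rw [Real.rpow_sub_one ha.ne']; ring
    linear_combination h - p * e

open Finset in
theorem rpow_sum_range_le {p : ℝ} (hp : 1 ≤ p) {a : ℕ → ℝ} (ha : ∀ n, 0 ≤ a n) (n : ℕ) :
    (∑ k ∈ range n, a k) ^ p ≤
      ∑ k ∈ range n, p * a k * (∑ j ∈ range (k + 1), a j) ^ (p - 1) := by
  induction n with
  | zero => simp [Real.zero_rpow (by linarith : p ≠ 0)]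
  | succ n ih =>
    rw [sum_range_succ (fun k => p * a k * _)]
    have hA := sum_nonneg fun k (_ : k ∈ range n) => ha k
    have hB : 0 ≤ ∑ k ∈ range (n + 1), a k := sum_nonneg fun k _ => ha k
    have h := rpow_tangent_le hp hB hA
    have e : (∑ k ∈ range (n + 1), a k) ^ p =
        (∑ k ∈ range (n + 1), a k) * (∑ k ∈ range (n + 1), a k) ^ (p - 1) := by
      rw [← Real.rpow_one_add' hB (by linarith)]; congr 1; ring
    have e' : ∑ k ∈ range (n + 1), a k = ∑ k ∈ range n, a k + a n := sum_range_succ a n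
    linear_combination ih + h + p * e +
      p * (∑ k ∈ range (n + 1), a k) ^ (p - 1) * e'

open Finset in
/-- The finite form of Leindler's inequality. -/
theorem sum_mul_rpow_sum_range_le {p : ℝ} (hp : 1 ≤ p) {a m : ℕ → ℝ} (ha : ∀ n, 0 ≤ a n)
    (hm : ∀ n, 0 < m n) (N : ℕ) :
    ∑ n ∈ range N, m n * (∑ k ∈ range (n + 1), a k) ^ p ≤
      p ^ p * ∑ n ∈ range N, m n ^ (1 - p) * (∑ k ∈ Ico n N, m k) ^ p * a n ^ p := by
  set A : ℕ → ℝ := fun n => ∑ k ∈ range (n + 1), a k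
  set M : ℕ → ℝ := fun n => ∑ k ∈ Ico n N, m k
  have hp0 : 0 < p := by linarith
  have hA n : 0 ≤ A n := sum_nonneg fun k _ => ha k
  have hM n : 0 ≤ M n := sum_nonneg fun k _ => (hm k).le
  have h1 : ∑ n ∈ range N, m n * A n ^ p ≤ ∑ k ∈ range N, M k * (p * a k * A k ^ (p - 1)) :=
    calc _ ≤ ∑ n ∈ range N, ∑ k ∈ range (n + 1), m n * (p * a k * A k ^ (p - 1)) :=
          sum_le_sum fun n _ => by
            rw [← mul_sum]
            exact mul_le_mul_of_nonneg_left (rpow_sum_range_le hp ha (n + 1)) (hm n).le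
      _ = ∑ k ∈ range N, ∑ n ∈ Ico k N, m n * (p * a k * A k ^ (p - 1)) :=
          sum_comm' fun x y => by simp only [mem_range, mem_Ico]; omega
      _ = _ := by simp only [M, sum_mul]
  have h2 : ∑ k ∈ range N, p * (M k * (p * a k * A k ^ (p - 1))) ≤
      ∑ k ∈ range N, (p ^ p * (m k ^ (1 - p) * M k ^ p * a k ^ p) +
        (p - 1) * (m k * A k ^ p)) := by
    refine sum_le_sum fun k _ => ?_
    have hmk := hm k
    have hy : 0 ≤ p * a k * M k / m k :=
      div_nonneg (mul_nonneg (mul_nonneg hp0.le (ha k)) (hM k)) hmk.le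
    have h := mul_le_mul_of_nonneg_left (rpow_tangent_le hp (hA k) hy) hmk.le
    have e : m k * (p * a k * M k / m k) ^ p =
        p ^ p * (m k ^ (1 - p) * M k ^ p * a k ^ p) := by
      rw [Real.div_rpow (mul_nonneg (mul_nonneg hp0.le (ha k)) (hM k)) hmk.le,
        Real.mul_rpow (mul_nonneg hp0.le (ha k)) (hM k), Real.mul_rpow hp0.le (ha k),
        Real.rpow_sub hmk, Real.rpow_one]
      ring
    have e' : m k * (p * (p * a k * M k / m k) * A k ^ (p - 1)) =
        p * (M k * (p * a k * A k ^ (p - 1))) := by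
      field_simp
    linarith
  rw [sum_add_distrib, ← mul_sum, ← mul_sum, ← mul_sum] at h2
  linarith [mul_le_mul_of_nonneg_left h1 hp0.le]


/-- Lemma 2, inequality (8) (Leindler):
`∑ μ_n (∑_{k≤n} α_k)^p ≤ p^p ∑ μ_n^{1-p} (∑_{k≥n} μ_k)^p α_n^p` in `[0,∞]`. -/
theorem stmt_6 (p : ℝ) (hp : 1 ≤ p) (α μ : ℕ → ℝ)
    (hα : ∀ n, 0 ≤ α n) (hμ : ∀ n, 0 < μ n) :
    ∑' n : ℕ, ENNReal.ofReal (μ (n + 1)) *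
        ENNReal.ofReal ((∑ k ∈ Finset.Icc 1 (n + 1), α k) ^ p) ≤
      ENNReal.ofReal (p ^ p) *
        ∑' n : ℕ, ENNReal.ofReal (μ (n + 1) ^ (1 - p)) *
          (∑' k : ℕ, ENNReal.ofReal (μ (n + 1 + k))) ^ p *
          ENNReal.ofReal (α (n + 1) ^ p) := by
  have hp0 : 0 ≤ p := by linarith
  have hI (n : ℕ) : ∑ k ∈ Finset.Icc 1 (n + 1), α k = ∑ k ∈ Finset.range (n + 1), α (k + 1) := by
    rw [Finset.range_eq_Ico, Finset.sum_Ico_add' α 0 (n + 1) 1]; rfl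
  have hM (n N : ℕ) : 0 ≤ ∑ k ∈ Finset.Ico n N, μ (k + 1) :=
    Finset.sum_nonneg fun k _ => (hμ _).le
  refine ENNReal.tsum_le_of_sum_range_le fun N => ?_
  have h := ENNReal.ofReal_le_ofReal (sum_mul_rpow_sum_range_le hp (a := fun n => α (n + 1))
    (m := fun n => μ (n + 1)) (fun n => hα _) (fun n => hμ _) N)
  have hA (n : ℕ) : 0 ≤ (∑ k ∈ Finset.range (n + 1), α (k + 1)) ^ p :=
    Real.rpow_nonneg (Finset.sum_nonneg fun k _ => hα _) p
  have hm (n : ℕ) : 0 ≤ μ (n + 1) ^ (1 - p) := Real.rpow_nonneg (hμ _).le _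
  have hMp (n : ℕ) := Real.rpow_nonneg (hM n N) p
  rw [ENNReal.ofReal_sum_of_nonneg fun n _ => mul_nonneg (hμ _).le (hA n),
    ENNReal.ofReal_mul (Real.rpow_nonneg hp0 p), ENNReal.ofReal_sum_of_nonneg fun n _ =>
      mul_nonneg (mul_nonneg (hm n) (hMp n)) (Real.rpow_nonneg (hα _) p)] at h
  simp only [hI, ← ENNReal.ofReal_mul (hμ _).le]
  refine h.trans (mul_le_mul_right ((Finset.sum_le_sum fun n _ => ?_).trans
    (ENNReal.sum_le_tsum (Finset.range N))) _)
  rw [ENNReal.ofReal_mul (mul_nonneg (hm n) (hMp n)), ENNReal.ofReal_mul (hm n),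
    ← ENNReal.ofReal_rpow_of_nonneg (hM n N) hp0]
  gcongr
  rw [ENNReal.ofReal_sum_of_nonneg fun k _ => (hμ _).le, Finset.sum_Ico_eq_sum_range]
  simp only [add_right_comm n _ 1]
  exact ENNReal.sum_le_tsum _
end

section
/- Let p ≥ 1, let (α_n)_{n≥1} be a sequence of nonnegative real numbers, and let (μ_n)_{n≥1} be a sequence of positive real numbers. Then ∑_{n=1}^∞ μ_n ( ∑_{k=n}^∞ α_k )^p ≤ p^p ∑_{n=1}^∞ μ_n^{1−p} ( ∑_{k=1}^n μ_k )^p α_n^p, where both sides are interpreted in the extended nonnegative reals (the inequality holding trivially if the right-hand side is infinite). -/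
/-- Young's inequality in the form `p x^{p-1} y ≤ (p-1) x^p + y^p`. -/
theorem mul_rpow_sub_one_mul_le {p x y : ℝ} (hp : 1 ≤ p) (hx : 0 ≤ x) (hy : 0 ≤ y) :
    p * x ^ (p - 1) * y ≤ (p - 1) * x ^ p + y ^ p := by
  have hp0 : 0 < p := by linarith
  have h := Real.geom_mean_le_arith_mean2_weighted (w₁ := (p - 1) / p) (w₂ := 1 / p)
    (p₁ := x ^ p) (p₂ := y ^ p) (div_nonneg (by linarith) hp0.le) (by positivity)
    (by positivity) (by positivity) (by field_simp; ring)
  rw [← Real.rpow_mul hx, ← Real.rpow_mul hy, mul_div_cancel₀ _ hp0.ne',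
    mul_div_cancel₀ _ hp0.ne', Real.rpow_one] at h
  have h2 := mul_le_mul_of_nonneg_left h hp0.le
  have e : p * ((p - 1) / p * x ^ p + 1 / p * y ^ p) = (p - 1) * x ^ p + y ^ p := by
    field_simp
  linarith

/-- Summation by parts. -/
theorem sum_range_mul_eq_sum_partial_sum_mul_sub (m B : ℕ → ℝ) (N : ℕ) :
    ∑ n ∈ Finset.range N, m n * B n =
      ∑ n ∈ Finset.range N, (∑ k ∈ Finset.range (n + 1), m k) * (B n - B (n + 1)) +
        (∑ k ∈ Finset.range N, m k) * B N := by
  induction N with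
  | zero => simp
  | succ N ih =>
    rw [Finset.sum_range_succ, ih, Finset.sum_range_succ _ N, Finset.sum_range_succ m N]
    ring

/-- The finite form of Leindler's inequality. -/
theorem sum_mul_sum_Ico_rpow_le {p : ℝ} (hp : 1 ≤ p) {a m : ℕ → ℝ}
    (ha : ∀ n, 0 ≤ a n) (hm : ∀ n, 0 < m n) (N : ℕ) :
    ∑ n ∈ Finset.range N, m n * (∑ k ∈ Finset.Ico n N, a k) ^ p ≤
      p ^ p * ∑ n ∈ Finset.range N,
        m n ^ (1 - p) * (∑ k ∈ Finset.range (n + 1), m k) ^ p * a n ^ p := by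
  have hp0 : 0 < p := by linarith
  set A : ℕ → ℝ := fun n => ∑ k ∈ Finset.Ico n N, a k with hA
  have hA0 : ∀ n, 0 ≤ A n := fun n => Finset.sum_nonneg fun k _ => ha k
  have hparts := sum_range_mul_eq_sum_partial_sum_mul_sub m (fun n => A n ^ p) N
  have hAN : A N ^ p = 0 := by simp [hA, Real.zero_rpow hp0.ne']
  simp only [hAN, mul_zero, add_zero] at hparts
  have hterm : ∀ n ∈ Finset.range N,
      p * ((∑ k ∈ Finset.range (n + 1), m k) * (A n ^ p - A (n + 1) ^ p)) ≤
        (p - 1) * (m n * A n ^ p) + p ^ p *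
          (m n ^ (1 - p) * (∑ k ∈ Finset.range (n + 1), m k) ^ p * a n ^ p) := by
    intro n hn
    have hM : 0 ≤ ∑ k ∈ Finset.range (n + 1), m k := Finset.sum_nonneg fun k _ => (hm k).le
    set M := ∑ k ∈ Finset.range (n + 1), m k
    have hstep : A n = a n + A (n + 1) :=
      Finset.sum_eq_sum_Ico_succ_bot (Finset.mem_range.mp hn) a
    have hpow : A n ^ p = A n ^ (p - 1) * A n := by
      rcases (hA0 n).eq_or_lt with h | h
      · rw [← h, Real.zero_rpow hp0.ne', mul_zero]
      · rw [Real.rpow_sub_one h.ne', div_mul_cancel₀ _ h.ne']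
    have hdiff : A n ^ p - A (n + 1) ^ p ≤ p * A n ^ (p - 1) * a n := by
      have h := mul_rpow_sub_one_mul_le hp (hA0 n) (hA0 (n + 1))
      have e : a n = A n - A (n + 1) := by linarith
      rw [e]
      linear_combination h + p * hpow
    have hy : 0 ≤ p * M * a n / m n :=
      div_nonneg (mul_nonneg (mul_nonneg hp0.le hM) (ha n)) (hm n).le
    have hyoung := mul_le_mul_of_nonneg_left (mul_rpow_sub_one_mul_le hp (hA0 n) hy) (hm n).le
    have hr : m n * (p * M * a n / m n) ^ p = p ^ p * (m n ^ (1 - p) * M ^ p * a n ^ p) := by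
      rw [Real.div_rpow (mul_nonneg (mul_nonneg hp0.le hM) (ha n)) (hm n).le,
        Real.mul_rpow (mul_nonneg hp0.le hM) (ha n), Real.mul_rpow hp0.le hM,
        Real.rpow_sub (hm n), Real.rpow_one]
      ring
    have hl : m n * (p * A n ^ (p - 1) * (p * M * a n / m n)) =
        p * (M * (p * A n ^ (p - 1) * a n)) := by
      have := (hm n).ne'
      field_simp
    have h1 := mul_le_mul_of_nonneg_left (mul_le_mul_of_nonneg_left hdiff hM) hp0.le
    rw [hl, mul_add, hr] at hyoung
    linarith only [hyoung, h1]
  have hsum := Finset.sum_le_sum hterm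
  rw [← Finset.mul_sum, ← hparts, Finset.sum_add_distrib, ← Finset.mul_sum,
    ← Finset.mul_sum] at hsum
  linarith

open Filter Topology in
/-- Lemma 2, inequality (9) (Leindler):
`∑ μ_n (∑_{k≥n} α_k)^p ≤ p^p ∑ μ_n^{1-p} (∑_{k≤n} μ_k)^p α_n^p` in `[0,∞]`. -/
theorem stmt_7 (p : ℝ) (hp : 1 ≤ p) (α μ : ℕ → ℝ)
    (hα : ∀ n, 0 ≤ α n) (hμ : ∀ n, 0 < μ n) :
    ∑' n : ℕ, ENNReal.ofReal (μ (n + 1)) *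
        (∑' k : ℕ, ENNReal.ofReal (α (n + 1 + k))) ^ p ≤
      ENNReal.ofReal (p ^ p) *
        ∑' n : ℕ, ENNReal.ofReal (μ (n + 1) ^ (1 - p)) *
          ENNReal.ofReal ((∑ k ∈ Finset.Icc 1 (n + 1), μ k) ^ p) *
          ENNReal.ofReal (α (n + 1) ^ p) := by
  have hp0 : 0 < p := by linarith
  refine ENNReal.tsum_le_of_sum_range_le fun N => ?_
  have hlim : Tendsto (fun K : ℕ => ∑ n ∈ Finset.range N, ENNReal.ofReal (μ (n + 1)) *
        (∑ k ∈ Finset.range K, ENNReal.ofReal (α (n + 1 + k))) ^ p) atTop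
      (𝓝 (∑ n ∈ Finset.range N, ENNReal.ofReal (μ (n + 1)) *
        (∑' k : ℕ, ENNReal.ofReal (α (n + 1 + k))) ^ p)) := by
    refine tendsto_finsetSum _ fun n _ => ?_
    refine ENNReal.Tendsto.const_mul ?_ (Or.inr ENNReal.ofReal_ne_top)
    exact ((ENNReal.continuous_rpow_const).tendsto _).comp (ENNReal.tendsto_nat_tsum _)
  refine le_of_tendsto' hlim fun K => ?_
  have hM : ∀ n, ∑ k ∈ Finset.Icc 1 (n + 1), μ k = ∑ k ∈ Finset.range (n + 1), μ (k + 1) := by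
    intro n
    rw [Finset.range_eq_Ico, Finset.sum_Ico_add' μ 0 (n + 1) 1]
    rfl
  have hM0 : ∀ n, 0 ≤ ∑ k ∈ Finset.range (n + 1), μ (k + 1) :=
    fun n => Finset.sum_nonneg fun k _ => (hμ _).le
  have hS0 : ∀ n, 0 ≤ ∑ k ∈ Finset.Ico n (N + K), α (k + 1) :=
    fun n => Finset.sum_nonneg fun k _ => hα _
  calc
    _ ≤ ∑ n ∈ Finset.range N, ENNReal.ofReal
          (μ (n + 1) * (∑ k ∈ Finset.Ico n (N + K), α (k + 1)) ^ p) := by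
        refine Finset.sum_le_sum fun n hn => ?_
        rw [ENNReal.ofReal_mul (hμ _).le, ← ENNReal.ofReal_rpow_of_nonneg (hS0 n) hp0.le,
          ← ENNReal.ofReal_sum_of_nonneg fun k _ => hα _]
        gcongr
        rw [Finset.sum_Ico_eq_sum_range]
        have hn' := Finset.mem_range.mp hn
        refine (Finset.sum_le_sum_of_subset_of_nonneg
          (Finset.range_mono (show K ≤ N + K - n by omega)) fun _ _ _ => hα _).trans_eq ?_
        exact Finset.sum_congr rfl fun k _ => by rw [add_right_comm]
    _ ≤ ∑ n ∈ Finset.range (N + K), ENNReal.ofReal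
          (μ (n + 1) * (∑ k ∈ Finset.Ico n (N + K), α (k + 1)) ^ p) :=
        Finset.sum_le_sum_of_subset (Finset.range_mono (Nat.le_add_right N K))
    _ = ENNReal.ofReal (∑ n ∈ Finset.range (N + K),
          μ (n + 1) * (∑ k ∈ Finset.Ico n (N + K), α (k + 1)) ^ p) :=
        (ENNReal.ofReal_sum_of_nonneg fun n _ =>
          mul_nonneg (hμ _).le (Real.rpow_nonneg (hS0 n) _)).symm
    _ ≤ ENNReal.ofReal (p ^ p * ∑ n ∈ Finset.range (N + K), μ (n + 1) ^ (1 - p) *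
          (∑ k ∈ Finset.range (n + 1), μ (k + 1)) ^ p * α (n + 1) ^ p) :=
        ENNReal.ofReal_le_ofReal (sum_mul_sum_Ico_rpow_le hp (fun n => hα (n + 1))
          (fun n => hμ (n + 1)) (N + K))
    _ = ENNReal.ofReal (p ^ p) * ∑ n ∈ Finset.range (N + K),
          ENNReal.ofReal (μ (n + 1) ^ (1 - p)) *
          ENNReal.ofReal ((∑ k ∈ Finset.Icc 1 (n + 1), μ k) ^ p) *
          ENNReal.ofReal (α (n + 1) ^ p) := by
        have h1 : ∀ n, 0 ≤ μ (n + 1) ^ (1 - p) := fun n => Real.rpow_nonneg (hμ _).le _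
        have h2 := fun n => Real.rpow_nonneg (hM0 n) p
        rw [ENNReal.ofReal_mul (by positivity), ENNReal.ofReal_sum_of_nonneg fun n _ =>
          mul_nonneg (mul_nonneg (h1 n) (h2 n)) (Real.rpow_nonneg (hα _) _)]
        congr 1
        refine Finset.sum_congr rfl fun n _ => ?_
        rw [hM, ENNReal.ofReal_mul (mul_nonneg (h1 n) (h2 n)), ENNReal.ofReal_mul (h1 n)]
    _ ≤ _ := by
        gcongr
        exact ENNReal.sum_le_tsum _
end

section
/- Let 1 < p < ∞ and 1/p − 1 < γ < 1/p, and let λ = (λ_n)_{n≥1} be a nonnegative sequence in the class GBV satisfying ∑_{n=1}^∞ n^{p+pγ−2} λ_n^p < ∞. Then there is a constant C > 0 (depending only on λ, p and γ) such that ∑_{n=1}^∞ n^{p+pγ−2} ( ∑_{k=n}^∞ |λ_k − λ_{k+1}| )^p ≤ C ∑_{n=1}^∞ n^{p+pγ−2} λ_n^p < ∞. -/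
open Filter

lemma rpow_le_two_rpow_abs_mul_rpow {x y : ℝ} (b : ℝ) (hx : 0 < x) (hxy : x ≤ y)
    (hyx : y ≤ 2 * x) : x ^ b ≤ 2 ^ |b| * y ^ b := by
  have hy : 0 < y := hx.trans_le hxy
  rcases le_total 0 b with hb | hb
  · calc x ^ b ≤ y ^ b := Real.rpow_le_rpow hx.le hxy hb
      _ ≤ 2 ^ |b| * y ^ b := le_mul_of_one_le_left (by positivity)
          (Real.one_le_rpow (by norm_num) (abs_nonneg b))
  · calc x ^ b ≤ (y / 2) ^ b := Real.rpow_le_rpow_of_nonpos (by positivity) (by linarith) hb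
      _ = 2 ^ |b| * y ^ b := by
          rw [Real.div_rpow hy.le (by norm_num), abs_of_nonpos hb, Real.rpow_neg (by norm_num)]
          field_simp

/-- The Jensen inequality for the function `x ^ p` and countably many weights. -/
lemma ENNReal.rpow_tsum_mul_le {p : ℝ} (hp : 1 ≤ p) (w f : ℕ → ENNReal) :
    (∑' i, w i * f i) ^ p ≤ (∑' i, w i) ^ (p - 1) * ∑' i, w i * f i ^ p := by
  have hp0 : 0 < p := by linarith
  have hle : ∑' i, w i * f i ≤ (∑' i, w i) ^ (1 - p⁻¹) * (∑' i, w i * f i ^ p) ^ p⁻¹ := by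
    rw [ENNReal.tsum_eq_iSup_sum]
    refine iSup_le fun s => (ENNReal.inner_le_weight_mul_Lp_of_nonneg s hp w f).trans ?_
    have : p⁻¹ ≤ 1 := inv_le_one_of_one_le₀ hp
    exact mul_le_mul' (ENNReal.rpow_le_rpow (ENNReal.sum_le_tsum s) (by linarith))
      (ENNReal.rpow_le_rpow (ENNReal.sum_le_tsum s) (by positivity))
  refine (ENNReal.rpow_le_rpow hle hp0.le).trans_eq ?_
  rw [ENNReal.mul_rpow_of_nonneg _ _ hp0.le, ← ENNReal.rpow_mul, ← ENNReal.rpow_mul,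
    inv_mul_cancel₀ hp0.ne', ENNReal.rpow_one, sub_mul, one_mul, inv_mul_cancel₀ hp0.ne']

section GBV

variable {lam : ℕ → ℝ} {M : ℝ}

lemma le_one_add_mul_of_gbv
    (hM : ∀ m : ℕ, 1 ≤ m → ∑ n ∈ Finset.Icc m (2 * m), |lam n - lam (n + 1)| ≤ M * lam m)
    {k m : ℕ} (hk : 1 ≤ k) (hkm : k ≤ m) (hmk : m ≤ 2 * k) : lam m ≤ (1 + M) * lam k := by
  have h1 := dist_le_Ico_sum_dist lam hkm
  simp only [Real.dist_eq] at h1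
  have h2 : ∑ i ∈ Finset.Ico k m, |lam i - lam (i + 1)| ≤
      ∑ i ∈ Finset.Icc k (2 * k), |lam i - lam (i + 1)| := by
    refine Finset.sum_le_sum_of_subset_of_nonneg (fun i hi => ?_) fun _ _ _ => abs_nonneg _
    simp only [Finset.mem_Ico, Finset.mem_Icc] at hi ⊢
    omega
  linarith [hM k hk, neg_abs_le (lam k - lam m)]

lemma tsum_abs_sub_le_of_gbv (hnn : ∀ n, 0 ≤ lam n) (hM0 : 0 < M)
    (hM : ∀ m : ℕ, 1 ≤ m → ∑ n ∈ Finset.Icc m (2 * m), |lam n - lam (n + 1)| ≤ M * lam m)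
    {n : ℕ} (hn : 1 ≤ n) :
    ∑' k : ℕ, ENNReal.ofReal |lam (n + k) - lam (n + k + 1)| ≤
      ENNReal.ofReal M * ∑' j : ℕ, ENNReal.ofReal (lam (2 ^ j * n)) := by
  have hdyadic : ∀ J : ℕ, ∑ i ∈ Finset.Ico n (2 ^ J * n), |lam i - lam (i + 1)| ≤
      ∑ j ∈ Finset.range J, M * lam (2 ^ j * n) := by
    intro J
    induction J with
    | zero => simp
    | succ J ih =>
      have h1 : 1 ≤ 2 ^ J * n := Nat.mul_pos (by positivity) hn
      rw [Finset.sum_range_succ, ← Finset.sum_Ico_consecutive _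
        (Nat.le_mul_of_pos_left n (by positivity) : n ≤ 2 ^ J * n)
        (Nat.mul_le_mul_right n (Nat.pow_le_pow_right (by norm_num) J.le_succ))]
      refine add_le_add ih (le_trans ?_ (hM _ h1))
      refine Finset.sum_le_sum_of_subset_of_nonneg (fun i hi => ?_) fun _ _ _ => abs_nonneg _
      rw [pow_succ'] at hi
      simp only [Finset.mem_Ico, Finset.mem_Icc, mul_assoc] at hi ⊢
      omega
  rw [ENNReal.tsum_eq_iSup_nat]
  refine iSup_le fun K => ?_
  have hsub : n + K ≤ 2 ^ K * n := by
    have : K + 1 ≤ 2 ^ K := Nat.lt_two_pow_self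
    nlinarith
  calc ∑ k ∈ Finset.range K, ENNReal.ofReal |lam (n + k) - lam (n + k + 1)|
      = ENNReal.ofReal (∑ i ∈ Finset.Ico n (n + K), |lam i - lam (i + 1)|) := by
        rw [Finset.sum_Ico_eq_sum_range, ENNReal.ofReal_sum_of_nonneg fun _ _ => abs_nonneg _]
        simp
    _ ≤ ENNReal.ofReal (∑ j ∈ Finset.range K, M * lam (2 ^ j * n)) :=
        ENNReal.ofReal_le_ofReal <| (Finset.sum_le_sum_of_subset_of_nonneg
          (Finset.Ico_subset_Ico_right hsub) fun _ _ _ => abs_nonneg _).trans (hdyadic K)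
    _ = ENNReal.ofReal M * ∑ j ∈ Finset.range K, ENNReal.ofReal (lam (2 ^ j * n)) := by
        rw [← Finset.mul_sum, ENNReal.ofReal_mul hM0.le,
          ENNReal.ofReal_sum_of_nonneg fun _ _ => hnn _]
    _ ≤ _ := by gcongr; exact ENNReal.sum_le_tsum _

/-- Each `lam (2 * N * n)` is compared with the `N` terms `lam (N * n + r)`, `r < N`; these blocks
are disjoint for different `n`. -/
lemma tsum_rpow_mul_dilate_le_of_gbv (hnn : ∀ n, 0 ≤ lam n) (hM0 : 0 < M)
    (hM : ∀ m : ℕ, 1 ≤ m → ∑ n ∈ Finset.Icc m (2 * m), |lam n - lam (n + 1)| ≤ M * lam m)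
    {p : ℝ} (hp : 0 ≤ p) (b : ℝ) {N : ℕ} (hN : 1 ≤ N) :
    ∑' n : ℕ, ENNReal.ofReal (((n + 1 : ℕ) : ℝ) ^ b * lam (2 * N * (n + 1)) ^ p) ≤
      ENNReal.ofReal ((1 + M) ^ p * 2 ^ |b| * (N : ℝ) ^ (-(b + 1))) *
        ∑' n : ℕ, ENNReal.ofReal (((n + 1 : ℕ) : ℝ) ^ b * lam (n + 1) ^ p) := by
  have hN0 : (0 : ℝ) < N := by exact_mod_cast hN
  set e : ℕ × Fin N → ℕ := fun x => N * x.1 + x.2 + (N - 1) with he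
  have heinj : Function.Injective e := by
    rintro ⟨a, r⟩ ⟨a', r'⟩ h
    have h' : N * a + r = N * a' + r' := by simpa [he] using h
    have hd := congrArg (· / N) h'
    simp only [Nat.mul_add_div hN, Nat.div_eq_of_lt r.2, Nat.div_eq_of_lt r'.2, add_zero] at hd
    subst hd
    simp only [Prod.mk.injEq, true_and]
    exact Fin.ext (by omega)
  set F : ℕ → ℝ := fun n => ((n + 1 : ℕ) : ℝ) ^ b * lam (n + 1) ^ p with hF
  set D : ℝ := (1 + M) ^ p * 2 ^ |b| * (N : ℝ) ^ (-(b + 1)) with hD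
  have hDnn : 0 ≤ D := by positivity
  have hpt : ∀ (n : ℕ) (r : Fin N),
      (N : ℝ)⁻¹ * (((n + 1 : ℕ) : ℝ) ^ b * lam (2 * N * (n + 1)) ^ p) ≤ D * F (e (n, r)) := by
    intro n r
    have hr := r.2
    have hk : e (n, r) + 1 = N * (n + 1) + r := by simp only [he, mul_add]; omega
    have hNn : N ≤ N * (n + 1) := Nat.le_mul_of_pos_right N n.succ_pos
    simp only [hF, hk]
    set k := N * (n + 1) + (r : ℕ)
    have hlam : lam (2 * N * (n + 1)) ≤ (1 + M) * lam k :=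
      le_one_add_mul_of_gbv hM (by omega) (by rw [mul_assoc]; omega)
        (by rw [mul_assoc]; omega)
    have hlamp : lam (2 * N * (n + 1)) ^ p ≤ (1 + M) ^ p * lam k ^ p := by
      rw [← Real.mul_rpow (by positivity) (hnn _)]
      exact Real.rpow_le_rpow (hnn _) hlam hp
    have hw : ((N * (n + 1) : ℕ) : ℝ) ^ b ≤ 2 ^ |b| * (k : ℝ) ^ b := by
      refine rpow_le_two_rpow_abs_mul_rpow b ?_ ?_ ?_
      · exact_mod_cast (by omega : 0 < N * (n + 1))
      · exact_mod_cast (by omega : N * (n + 1) ≤ k)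
      · exact_mod_cast (by omega : k ≤ 2 * (N * (n + 1)))
    have hsplit : (N : ℝ)⁻¹ * ((n + 1 : ℕ) : ℝ) ^ b =
        (N : ℝ) ^ (-(b + 1)) * ((N * (n + 1) : ℕ) : ℝ) ^ b := by
      rw [Nat.cast_mul, Real.mul_rpow hN0.le (by positivity), ← mul_assoc, ← Real.rpow_add hN0,
        ← Real.rpow_neg_one]
      congr 2
      ring
    rw [← mul_assoc, hsplit]
    calc _ ≤ (N : ℝ) ^ (-(b + 1)) * (2 ^ |b| * (k : ℝ) ^ b) * ((1 + M) ^ p * lam k ^ p) := by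
          have := Real.rpow_nonneg (hnn (2 * N * (n + 1))) p
          gcongr
      _ = _ := by rw [hD]; ring
  calc _ = ∑' n : ℕ, ∑' _ : Fin N, ENNReal.ofReal
        ((N : ℝ)⁻¹ * (((n + 1 : ℕ) : ℝ) ^ b * lam (2 * N * (n + 1)) ^ p)) := by
        refine tsum_congr fun n => ?_
        rw [tsum_fintype, Finset.sum_const, Finset.card_univ, Fintype.card_fin, nsmul_eq_mul,
          ← ENNReal.ofReal_natCast, ← ENNReal.ofReal_mul hN0.le, mul_inv_cancel_left₀ hN0.ne']
    _ ≤ ∑' n : ℕ, ∑' r : Fin N, ENNReal.ofReal D * ENNReal.ofReal (F (e (n, r))) := by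
        refine ENNReal.tsum_le_tsum fun n => ENNReal.tsum_le_tsum fun r => ?_
        rw [← ENNReal.ofReal_mul hDnn]
        exact ENNReal.ofReal_le_ofReal (hpt n r)
    _ = ENNReal.ofReal D * ∑' x : ℕ × Fin N, ENNReal.ofReal (F (e x)) := by
        simp only [ENNReal.tsum_prod', ENNReal.tsum_mul_left]
    _ ≤ ENNReal.ofReal D * ∑' n : ℕ, ENNReal.ofReal (F n) := by
        gcongr
        exact ENNReal.tsum_comp_le_tsum_of_injective heinj fun n => ENNReal.ofReal (F n)

lemma exists_tsum_rpow_mul_dyadic_dilate_le_of_gbv (hnn : ∀ n, 0 ≤ lam n) (hM0 : 0 < M)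
    (hM : ∀ m : ℕ, 1 ≤ m → ∑ n ∈ Finset.Icc m (2 * m), |lam n - lam (n + 1)| ≤ M * lam m)
    {p : ℝ} (hp : 0 ≤ p) (b : ℝ) :
    ∃ D : ℝ, 0 ≤ D ∧ ∀ j : ℕ,
      ∑' n : ℕ, ENNReal.ofReal (((n + 1 : ℕ) : ℝ) ^ b * lam (2 ^ j * (n + 1)) ^ p) ≤
        ENNReal.ofReal (D * ((2 : ℝ) ^ (-(b + 1))) ^ j) *
          ∑' n : ℕ, ENNReal.ofReal (((n + 1 : ℕ) : ℝ) ^ b * lam (n + 1) ^ p) := by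
  have hnn' : 0 ≤ (1 + M) ^ p * 2 ^ |b| * (2 : ℝ) ^ (b + 1) := by positivity
  refine ⟨1 + (1 + M) ^ p * 2 ^ |b| * 2 ^ (b + 1), by positivity, fun j => ?_⟩
  rcases j with _ | j
  · simp only [pow_zero, one_mul, mul_one]
    exact le_mul_of_one_le_left' (ENNReal.one_le_ofReal.2 (by linarith))
  · rw [pow_succ' 2 j]
    refine (tsum_rpow_mul_dilate_le_of_gbv hnn hM0 hM hp b
      (Nat.one_le_two_pow : 1 ≤ 2 ^ j)).trans ?_
    refine mul_le_mul_left (ENNReal.ofReal_le_ofReal ?_) _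
    have h1 : (((2 ^ j : ℕ) : ℝ)) ^ (-(b + 1)) = ((2 : ℝ) ^ (-(b + 1))) ^ j := by
      rw [Nat.cast_pow, Nat.cast_ofNat, ← Real.rpow_natCast, ← Real.rpow_natCast,
        ← Real.rpow_mul (by norm_num), ← Real.rpow_mul (by norm_num), mul_comm]
    have h2 : (2 : ℝ) ^ (b + 1) * 2 ^ (-(b + 1)) = 1 := by
      rw [← Real.rpow_add (by norm_num), add_neg_cancel, Real.rpow_zero]
    rw [h1, pow_succ']
    set s := (2 : ℝ) ^ (-(b + 1))
    have hs0 : 0 < s := by positivity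
    calc (1 + M) ^ p * 2 ^ |b| * s ^ j
        = (1 + M) ^ p * 2 ^ |b| * 2 ^ (b + 1) * (s * s ^ j) := by
          linear_combination (-((1 + M) ^ p * 2 ^ |b| * s ^ j)) * h2
      _ ≤ (1 + (1 + M) ^ p * 2 ^ |b| * 2 ^ (b + 1)) * (s * s ^ j) := by
          refine mul_le_mul_of_nonneg_right ?_ (by positivity)
          linarith

end GBV

/-- Sufficiency step of Theorem 1.3: for `λ ∈ GBV` with `∑ n^{p+pγ-2} λ_n^p < ∞`,
`∑ n^{p+pγ-2} (∑_{k≥n} |λ_k - λ_{k+1}|)^p ≤ C ∑ n^{p+pγ-2} λ_n^p < ∞`. -/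
theorem stmt_9 (p γ : ℝ) (hp1 : 1 < p) (hγ1 : 1 / p - 1 < γ) (hγ2 : γ < 1 / p)
    (lam : ℕ → ℝ) (hnn : ∀ n, 0 ≤ lam n) (hlim : Tendsto lam atTop (nhds 0))
    (hGBV : ∃ M : ℝ, 0 < M ∧ ∀ m : ℕ, 1 ≤ m →
      ∑ n ∈ Finset.Icc m (2 * m), |lam n - lam (n + 1)| ≤ M * lam m)
    (hsum : Summable (fun n : ℕ => ((n + 1 : ℕ) : ℝ) ^ (p + p * γ - 2) * lam (n + 1) ^ p)) :
    ∃ C : ℝ, 0 < C ∧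
      ∑' n : ℕ, ENNReal.ofReal (((n + 1 : ℕ) : ℝ) ^ (p + p * γ - 2)) *
          (∑' k : ℕ, ENNReal.ofReal |lam (n + 1 + k) - lam (n + 1 + k + 1)|) ^ p ≤
        ENNReal.ofReal
          (C * ∑' n : ℕ, ((n + 1 : ℕ) : ℝ) ^ (p + p * γ - 2) * lam (n + 1) ^ p) := by
  obtain ⟨M, hM0, hM⟩ := hGBV
  have hp0 : 0 < p := by linarith
  have hb : 0 < p + p * γ - 2 + 1 := by
    have := mul_lt_mul_of_pos_left hγ1 hp0
    rw [mul_sub, mul_one_div_cancel hp0.ne'] at this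
    linarith
  set b := p + p * γ - 2
  obtain ⟨D, hD0, hD⟩ := exists_tsum_rpow_mul_dyadic_dilate_le_of_gbv hnn hM0 hM hp0.le b
  set S := ∑' n : ℕ, ENNReal.ofReal (((n + 1 : ℕ) : ℝ) ^ b * lam (n + 1) ^ p)
  set t : ℝ := 2 ^ (-(b + 1) / p) with ht
  have ht0 : 0 < t := by positivity
  have ht1 : t < 1 := Real.rpow_lt_one_of_one_lt_of_neg (by norm_num)
    (div_neg_of_neg_of_pos (by linarith) hp0)
  have htp : t ^ p = 2 ^ (-(b + 1)) := by
    rw [ht, ← Real.rpow_mul (by norm_num), div_mul_cancel₀ _ hp0.ne']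
  set w : ℕ → ENNReal := fun j => ENNReal.ofReal (t ^ j) with hw
  set K := ∑' j, w j with hK
  have hKtop : K ≠ ⊤ := (summable_geometric_of_lt_one ht0.le ht1).tsum_ofReal_ne_top
  have hjensen : ∀ n : ℕ, (∑' j : ℕ, ENNReal.ofReal (lam (2 ^ j * (n + 1)))) ^ p ≤
      K ^ (p - 1) * ∑' j : ℕ, ENNReal.ofReal
        (t ^ j * ((2 ^ (-(b + 1))) ^ j)⁻¹ * lam (2 ^ j * (n + 1)) ^ p) := by
    intro n
    convert ENNReal.rpow_tsum_mul_le hp1.le w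
      (fun j => ENNReal.ofReal ((t ^ j)⁻¹ * lam (2 ^ j * (n + 1)))) using 4 with j j
    · rw [hw, ← ENNReal.ofReal_mul (by positivity), mul_inv_cancel_left₀ (by positivity)]
    · rw [ENNReal.ofReal_rpow_of_nonneg (mul_nonneg (by positivity) (hnn _)) hp0.le, hw,
        ← ENNReal.ofReal_mul (by positivity), Real.mul_rpow (by positivity) (hnn _),
        Real.inv_rpow (by positivity), ← Real.rpow_pow_comm ht0.le, htp, mul_assoc]
  have hbound : ∑' n : ℕ, ENNReal.ofReal (((n + 1 : ℕ) : ℝ) ^ b) *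
      (∑' k : ℕ, ENNReal.ofReal |lam (n + 1 + k) - lam (n + 1 + k + 1)|) ^ p ≤
      ENNReal.ofReal M ^ p * K ^ (p - 1) * (ENNReal.ofReal D * K) * S := by
    calc _ ≤ ∑' n : ℕ, ENNReal.ofReal M ^ p * K ^ (p - 1) * ∑' j : ℕ,
          ENNReal.ofReal (t ^ j * ((2 ^ (-(b + 1))) ^ j)⁻¹) *
            ENNReal.ofReal (((n + 1 : ℕ) : ℝ) ^ b * lam (2 ^ j * (n + 1)) ^ p) := by
          refine ENNReal.tsum_le_tsum fun n => ?_
          refine (mul_le_mul_right (ENNReal.rpow_le_rpow (tsum_abs_sub_le_of_gbv hnn hM0 hM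
            (by omega : 1 ≤ n + 1)) hp0.le) _).trans ?_
          rw [ENNReal.mul_rpow_of_nonneg _ _ hp0.le]
          refine (mul_le_mul_right (mul_le_mul_right (hjensen n) _) _).trans_eq ?_
          rw [← mul_assoc (ENNReal.ofReal M ^ p), mul_left_comm, ← ENNReal.tsum_mul_left]
          congr 2 with j
          rw [← ENNReal.ofReal_mul (by positivity), ← ENNReal.ofReal_mul (by positivity)]
          congr 1
          ring
      _ = ENNReal.ofReal M ^ p * K ^ (p - 1) * ∑' j : ℕ,
          ENNReal.ofReal (t ^ j * ((2 ^ (-(b + 1))) ^ j)⁻¹) *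
            ∑' n : ℕ, ENNReal.ofReal (((n + 1 : ℕ) : ℝ) ^ b * lam (2 ^ j * (n + 1)) ^ p) := by
          rw [ENNReal.tsum_mul_left, ENNReal.tsum_comm]
          simp only [ENNReal.tsum_mul_left]
      _ ≤ ENNReal.ofReal M ^ p * K ^ (p - 1) * ∑' j : ℕ, ENNReal.ofReal D * w j * S := by
          refine mul_le_mul_right (ENNReal.tsum_le_tsum fun j => ?_) _
          refine (mul_le_mul_right (hD j) _).trans_eq ?_
          rw [← mul_assoc, ← ENNReal.ofReal_mul (by positivity), hw, ← ENNReal.ofReal_mul hD0]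
          congr 2
          field_simp
      _ = _ := by
          rw [ENNReal.tsum_mul_right, ENNReal.tsum_mul_left, ← hK, ← mul_assoc]
  have hSeq : S = ENNReal.ofReal (∑' n : ℕ, ((n + 1 : ℕ) : ℝ) ^ b * lam (n + 1) ^ p) :=
    (ENNReal.ofReal_tsum_of_nonneg
      (fun n => mul_nonneg (by positivity) (Real.rpow_nonneg (hnn _) _)) hsum).symm
  set E := ENNReal.ofReal M ^ p * K ^ (p - 1) * (ENNReal.ofReal D * K)
  have hEtop : E ≠ ⊤ := ENNReal.mul_ne_top (ENNReal.mul_ne_top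
    (ENNReal.rpow_ne_top_of_nonneg hp0.le ENNReal.ofReal_ne_top)
    (ENNReal.rpow_ne_top_of_nonneg (by linarith) hKtop))
    (ENNReal.mul_ne_top ENNReal.ofReal_ne_top hKtop)
  refine ⟨E.toReal + 1, by positivity, hbound.trans ?_⟩
  rw [ENNReal.ofReal_mul (by positivity), ← hSeq]
  gcongr
  exact (ENNReal.ofReal_toReal hEtop).symm.le.trans (ENNReal.ofReal_le_ofReal (by linarith))
end

section
/- Let λ = (λ_n)_{n≥1} be a nonnegative sequence in the class GBV. Then there is a constant C > 0 (depending only on λ) such that for every n ≥ 1 both λ_{2n} ≤ C ∑_{k=n}^∞ k^{−1} λ_k and λ_{2n+1} ≤ C ∑_{k=n}^∞ k^{−1} λ_k. -/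
open Filter

/-- A bound on the variation over `[m, 2m]` bounds `lam l` by `lam m` for `m ≤ l ≤ 2m + 1`. -/
lemma le_one_add_mul_of_sum_abs_sub_le {lam : ℕ → ℝ} {M : ℝ} {m l : ℕ}
    (h : ∑ n ∈ Finset.Icc m (2 * m), |lam n - lam (n + 1)| ≤ M * lam m)
    (hml : m ≤ l) (hl : l ≤ 2 * m + 1) : lam l ≤ (1 + M) * lam m := by
  have hdist : |lam m - lam l| ≤ ∑ n ∈ Finset.Ico m l, |lam n - lam (n + 1)| :=
    dist_le_Ico_sum_dist lam hml
  have hsub : ∑ n ∈ Finset.Ico m l, |lam n - lam (n + 1)| ≤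
      ∑ n ∈ Finset.Icc m (2 * m), |lam n - lam (n + 1)| := by
    refine Finset.sum_le_sum_of_subset_of_nonneg (fun n hn ↦ ?_) fun _ _ _ ↦ abs_nonneg _
    simp only [Finset.mem_Ico, Finset.mem_Icc] at hn ⊢
    omega
  linarith [neg_abs_le (lam m - lam l)]

/-- A number dominated by `K * lam k` for all `n ≤ k ≤ 2n` is dominated by `2 * K` times the
tail `∑_{k ≥ n} k⁻¹ * lam k`. -/
lemma ofReal_le_mul_tsum_inv_mul {lam : ℕ → ℝ} (hnn : ∀ n, 0 ≤ lam n) {K x : ℝ} (hK : 0 < K)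
    (hx : 0 ≤ x) {n : ℕ} (hn : 1 ≤ n) (h : ∀ k, n ≤ k → k ≤ 2 * n → x ≤ K * lam k) :
    ENNReal.ofReal x ≤
      ENNReal.ofReal (2 * K) * ∑' k : ℕ, ENNReal.ofReal (((n + k : ℕ) : ℝ)⁻¹ * lam (n + k)) := by
  have hn0 : (0 : ℝ) < n := by exact_mod_cast hn
  have hterm : ∀ k ∈ Finset.range n,
      (2 * n : ℝ)⁻¹ * (x / K) ≤ ((n + k : ℕ) : ℝ)⁻¹ * lam (n + k) := by
    intro k hk
    have hkn : k < n := Finset.mem_range.mp hk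
    have hle : ((n + k : ℕ) : ℝ) ≤ 2 * n := by
      exact_mod_cast (show n + k ≤ 2 * n by omega)
    have hpos : (0 : ℝ) < ((n + k : ℕ) : ℝ) := by
      exact_mod_cast (show 0 < n + k by omega)
    have hlam : x / K ≤ lam (n + k) := by
      rw [div_le_iff₀' hK]
      exact h _ (by omega) (by omega)
    gcongr
  have hsum := Finset.sum_le_sum hterm
  rw [Finset.sum_const, Finset.card_range, nsmul_eq_mul] at hsum
  calc ENNReal.ofReal x
      = ENNReal.ofReal (2 * K * (n * ((2 * n : ℝ)⁻¹ * (x / K)))) := by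
        congr 1
        field_simp
    _ ≤ ENNReal.ofReal
          (2 * K * ∑ k ∈ Finset.range n, ((n + k : ℕ) : ℝ)⁻¹ * lam (n + k)) := by
        gcongr
    _ = ENNReal.ofReal (2 * K) *
          ∑ k ∈ Finset.range n, ENNReal.ofReal (((n + k : ℕ) : ℝ)⁻¹ * lam (n + k)) := by
        rw [ENNReal.ofReal_mul (by positivity), ENNReal.ofReal_sum_of_nonneg]
        exact fun k _ ↦ mul_nonneg (by positivity) (hnn _)
    _ ≤ _ := by
        gcongr
        exact ENNReal.sum_le_tsum _

/-- For `λ ∈ GBV`: `λ_{2n} ≤ C ∑_{k≥n} k⁻¹ λ_k` and `λ_{2n+1} ≤ C ∑_{k≥n} k⁻¹ λ_k`. -/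
theorem stmt_11 (lam : ℕ → ℝ) (hnn : ∀ n, 0 ≤ lam n) (hlim : Tendsto lam atTop (nhds 0))
    (hGBV : ∃ M : ℝ, 0 < M ∧ ∀ m : ℕ, 1 ≤ m →
      ∑ n ∈ Finset.Icc m (2 * m), |lam n - lam (n + 1)| ≤ M * lam m) :
    ∃ C : ℝ, 0 < C ∧ ∀ n : ℕ, 1 ≤ n →
      ENNReal.ofReal (lam (2 * n)) ≤
        ENNReal.ofReal C * ∑' k : ℕ, ENNReal.ofReal (((n + k : ℕ) : ℝ)⁻¹ * lam (n + k)) ∧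
      ENNReal.ofReal (lam (2 * n + 1)) ≤
        ENNReal.ofReal C * ∑' k : ℕ, ENNReal.ofReal (((n + k : ℕ) : ℝ)⁻¹ * lam (n + k)) := by
  obtain ⟨M, hM, hvar⟩ := hGBV
  refine ⟨2 * (1 + M), by positivity, fun n hn ↦ ⟨?_, ?_⟩⟩ <;>
  exact ofReal_le_mul_tsum_inv_mul hnn (by positivity) (hnn _) hn fun k hnk hkn ↦
    le_one_add_mul_of_sum_abs_sub_le (hvar k (by omega)) (by omega) (by omega)
end

section
/- Let b = (b_n)_{n≥1} be a nonnegative sequence tending to zero that is quasimonotone, i.e. there exists α ≥ 0 such that b_{n+1} ≤ b_n (1 + α/n) for all n ≥ 1. Then b belongs to the class GBV. -/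
open Filter

/-- A quasimonotone sequence grows at most geometrically with ratio `1 + α / m` after index `m`. -/
lemma quasimonotone_le_exp {b : ℕ → ℝ} (hnn : ∀ n, 0 ≤ b n) {α : ℝ} (hα : 0 ≤ α)
    (hb : ∀ n : ℕ, 1 ≤ n → b (n + 1) ≤ b n * (1 + α / n)) {m : ℕ} (hm : 1 ≤ m) (k : ℕ) :
    b (m + k) ≤ b m * Real.exp (k * (α / m)) := by
  have hm0 : (0 : ℝ) < m := by exact_mod_cast hm
  induction k with
  | zero => simp
  | succ k ih =>
    have hle : α / ((m + k : ℕ) : ℝ) ≤ α / m := by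
      gcongr
      exact Nat.le_add_right m k
    calc b (m + k + 1) ≤ b (m + k) * (1 + α / ((m + k : ℕ) : ℝ)) := hb _ (by omega)
      _ ≤ b (m + k) * Real.exp (α / m) := by
        refine mul_le_mul_of_nonneg_left ?_ (hnn _)
        linarith [Real.add_one_le_exp (α / m)]
      _ ≤ b m * Real.exp (k * (α / m)) * Real.exp (α / m) := by gcongr
      _ = b m * Real.exp ((k + 1 : ℕ) * (α / m)) := by
        rw [mul_assoc, ← Real.exp_add]
        push_cast
        ring_nf

/-- A variation bound for a quasimonotone sequence over a block of indices starting at `m`. -/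
lemma sum_abs_sub_le_of_quasimonotone {b : ℕ → ℝ} (hnn : ∀ n, 0 ≤ b n) {α : ℝ} (hα : 0 ≤ α)
    (hb : ∀ n : ℕ, 1 ≤ n → b (n + 1) ≤ b n * (1 + α / n)) {m : ℕ} (hm : 1 ≤ m) {k : ℕ}
    (hk : k ≤ m + 1) :
    ∑ i ∈ Finset.range k, |b (m + i) - b (m + i + 1)| ≤
      b m - b (m + k) + k * (2 * (α / m * (b m * Real.exp α))) := by
  have hm0 : (0 : ℝ) < m := by exact_mod_cast hm
  induction k with
  | zero => simp
  | succ k ih =>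
    have hle : α / ((m + k : ℕ) : ℝ) ≤ α / m := by
      gcongr
      exact Nat.le_add_right m k
    have hkm : (k : ℝ) ≤ m := by exact_mod_cast (by omega : k ≤ m)
    have hexp : (k : ℝ) * (α / m) ≤ α := by
      calc (k : ℝ) * (α / m) ≤ m * (α / m) := by gcongr
        _ = α := by field_simp
    have hgrow : b (m + k) ≤ b m * Real.exp α :=
      (quasimonotone_le_exp hnn hα hb hm k).trans
        (mul_le_mul_of_nonneg_left (Real.exp_le_exp.2 hexp) (hnn m))
    have hprod : α / ((m + k : ℕ) : ℝ) * b (m + k) ≤ α / m * (b m * Real.exp α) :=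
      mul_le_mul hle hgrow (hnn _) (by positivity)
    have hpos : 0 ≤ α / m * (b m * Real.exp α) :=
      mul_nonneg (by positivity) (mul_nonneg (hnn m) (Real.exp_nonneg α))
    have hstep := hb (m + k) (by omega)
    have habs : |b (m + k) - b (m + k + 1)| ≤
        b (m + k) - b (m + k + 1) + 2 * (α / m * (b m * Real.exp α)) :=
      abs_le.2 ⟨by linarith, by linarith⟩
    rw [Finset.sum_range_succ]
    push_cast
    rw [← add_assoc m k 1]
    linarith [ih (by omega)]

/-- Every quasimonotone nonnegative null sequence belongs to GBV. -/
theorem stmt_13 (b : ℕ → ℝ) (hnn : ∀ n, 0 ≤ b n) (hlim : Tendsto b atTop (nhds 0))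
    (hqm : ∃ α : ℝ, 0 ≤ α ∧ ∀ n : ℕ, 1 ≤ n → b (n + 1) ≤ b n * (1 + α / n)) :
    ∃ M : ℝ, 0 < M ∧ ∀ m : ℕ, 1 ≤ m →
      ∑ n ∈ Finset.Icc m (2 * m), |b n - b (n + 1)| ≤ M * b m := by
  obtain ⟨α, hα, hb⟩ := hqm
  refine ⟨1 + 4 * α * Real.exp α, by positivity, fun m hm => ?_⟩
  have hm1 : (1 : ℝ) ≤ m := by exact_mod_cast hm
  have hsum : ∑ n ∈ Finset.Icc m (2 * m), |b n - b (n + 1)| =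
      ∑ i ∈ Finset.range (m + 1), |b (m + i) - b (m + i + 1)| := by
    rw [← Finset.Ico_add_one_right_eq_Icc, Finset.sum_Ico_eq_sum_range,
      show 2 * m + 1 - m = m + 1 by omega]
  have hbound := sum_abs_sub_le_of_quasimonotone hnn hα hb hm le_rfl
  have hpos : 0 ≤ α / m * (b m * Real.exp α) :=
    mul_nonneg (by positivity) (mul_nonneg (hnn m) (Real.exp_nonneg α))
  have hcount : ((m + 1 : ℕ) : ℝ) * (2 * (α / m * (b m * Real.exp α))) ≤
      4 * α * Real.exp α * b m := by
    calc ((m + 1 : ℕ) : ℝ) * (2 * (α / m * (b m * Real.exp α)))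
        ≤ (2 * m) * (2 * (α / m * (b m * Real.exp α))) := by
          refine mul_le_mul_of_nonneg_right ?_ (by linarith)
          push_cast
          linarith
      _ = 4 * α * Real.exp α * b m := by
          field_simp
          ring
  rw [hsum]
  linarith [hnn (m + (m + 1))]
end

section
/- Let λ = (λ_n)_{n≥1} be a nonnegative sequence in the class GBV. Then there is a constant C > 0 (depending only on λ) such that for every m ≥ 1, ∑_{k=1}^m k^2 |λ_k − λ_{k+1}| ≤ C ∑_{k=1}^m k λ_k. -/
open Filter

/-- The integers of `[n / 2, n]` number at least `n / 2`, hence their sum is at least `n² / 4`. -/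
lemma sq_le_four_mul_sum_Icc_half (n : ℕ) :
    (n : ℝ) ^ 2 ≤ 4 * ∑ k ∈ Finset.Icc ((n + 1) / 2) n, (k : ℝ) := by
  have hsum : (n + 1 - (n + 1) / 2) * ((n + 1) / 2) ≤ ∑ k ∈ Finset.Icc ((n + 1) / 2) n, k := by
    have h := Finset.card_nsmul_le_sum (Finset.Icc ((n + 1) / 2) n) (fun k => k) ((n + 1) / 2)
      fun k hk => (Finset.mem_Icc.mp hk).1
    simpa using h
  have hprod : n * n ≤ (2 * (n + 1 - (n + 1) / 2)) * (2 * ((n + 1) / 2)) :=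
    Nat.mul_le_mul (by omega) (by omega)
  have h : n ^ 2 ≤ 4 * ∑ k ∈ Finset.Icc ((n + 1) / 2) n, k := by nlinarith
  calc (n : ℝ) ^ 2 ≤ ((4 * ∑ k ∈ Finset.Icc ((n + 1) / 2) n, k : ℕ) : ℝ) := mod_cast h
    _ = 4 * ∑ k ∈ Finset.Icc ((n + 1) / 2) n, (k : ℝ) := by push_cast; rfl

/-- A weighted sum of a nonnegative sequence is controlled by its sums over dyadic blocks. -/
lemma sum_sq_mul_le_four_mul_sum_dyadic {d : ℕ → ℝ} (hd : ∀ n, 0 ≤ d n) (m : ℕ) :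
    ∑ n ∈ Finset.Icc 1 m, (n : ℝ) ^ 2 * d n ≤
      4 * ∑ k ∈ Finset.Icc 1 m, (k : ℝ) * ∑ n ∈ Finset.Icc k (2 * k), d n := by
  calc ∑ n ∈ Finset.Icc 1 m, (n : ℝ) ^ 2 * d n
      ≤ ∑ n ∈ Finset.Icc 1 m, (4 * ∑ k ∈ Finset.Icc ((n + 1) / 2) n, (k : ℝ)) * d n :=
        Finset.sum_le_sum fun n _ =>
          mul_le_mul_of_nonneg_right (sq_le_four_mul_sum_Icc_half n) (hd n)
    _ = 4 * ∑ n ∈ Finset.Icc 1 m, ∑ k ∈ Finset.Icc ((n + 1) / 2) n, (k : ℝ) * d n := by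
        simp only [Finset.mul_sum, Finset.sum_mul, mul_assoc]
    _ = 4 * ∑ k ∈ Finset.Icc 1 m,
          ∑ n ∈ (Finset.Icc k (2 * k)).filter (· ≤ m), (k : ℝ) * d n := by
        congr 1
        refine Finset.sum_comm' fun n k => ?_
        simp only [Finset.mem_Icc, Finset.mem_filter]
        omega
    _ ≤ 4 * ∑ k ∈ Finset.Icc 1 m, (k : ℝ) * ∑ n ∈ Finset.Icc k (2 * k), d n := by
        simp only [← Finset.mul_sum]
        gcongr with k
        · exact fun n _ _ => hd n
        · exact Finset.filter_subset _ _

/-- For `λ ∈ GBV`: `∑_{k≤m} k² |λ_k - λ_{k+1}| ≤ C ∑_{k≤m} k λ_k`. -/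
theorem stmt_14 (lam : ℕ → ℝ) (hnn : ∀ n, 0 ≤ lam n) (hlim : Tendsto lam atTop (nhds 0))
    (hGBV : ∃ M : ℝ, 0 < M ∧ ∀ m : ℕ, 1 ≤ m →
      ∑ n ∈ Finset.Icc m (2 * m), |lam n - lam (n + 1)| ≤ M * lam m) :
    ∃ C : ℝ, 0 < C ∧ ∀ m : ℕ, 1 ≤ m →
      ∑ k ∈ Finset.Icc 1 m, (k : ℝ) ^ 2 * |lam k - lam (k + 1)| ≤
        C * ∑ k ∈ Finset.Icc 1 m, (k : ℝ) * lam k := by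
  obtain ⟨M, hM, h⟩ := hGBV
  refine ⟨4 * M, by positivity, fun m _ => ?_⟩
  refine (sum_sq_mul_le_four_mul_sum_dyadic (fun n => abs_nonneg (lam n - lam (n + 1))) m).trans ?_
  rw [mul_assoc, Finset.mul_sum (Finset.Icc 1 m) _ M]
  refine mul_le_mul_of_nonneg_left (Finset.sum_le_sum fun k hk => ?_) (by norm_num)
  calc (k : ℝ) * ∑ n ∈ Finset.Icc k (2 * k), |lam n - lam (n + 1)|
      ≤ k * (M * lam k) :=
        mul_le_mul_of_nonneg_left (h k (Finset.mem_Icc.mp hk).1) k.cast_nonneg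
    _ = M * (k * lam k) := mul_left_comm _ _ _
end

section
/- Let λ = (λ_n)_{n≥1} be a nonnegative sequence in the class GBV. Then there is a constant C > 0 (depending only on λ) such that for all positive integers m < n, ∑_{k=m+1}^n k |λ_k − λ_{k+1}| ≤ C ( ∑_{k=m+1}^n λ_k + m λ_m ). -/
open Filter

lemma sum_ite_mem_Icc_le {d : ℕ → ℝ} (hd : ∀ k, 0 ≤ d k) (s : Finset ℕ) (j : ℕ) :
    ∑ k ∈ s, (if k ∈ Finset.Icc j (2 * j) then d k else 0) ≤
      ∑ k ∈ Finset.Icc j (2 * j), d k := by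
  rw [← Finset.sum_filter]
  refine Finset.sum_le_sum_of_subset_of_nonneg ?_ fun k _ _ => hd k
  intro k hk
  exact (Finset.mem_filter.1 hk).2

/-- If `2 * m < k ≤ n`, at least `k / 2` of the intervals `[j, 2j]`, `m < j ≤ n`, contain `k`. -/
lemma mul_le_two_mul_sum_ite_mem_Icc {m n k : ℕ} (hmk : 2 * m < k) (hkn : k ≤ n) {x : ℝ}
    (hx : 0 ≤ x) :
    (k : ℝ) * x ≤
      2 * ∑ j ∈ Finset.Icc (m + 1) n, (if k ∈ Finset.Icc j (2 * j) then x else 0) := by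
  rw [← Finset.sum_filter, Finset.sum_const, nsmul_eq_mul, ← mul_assoc]
  refine mul_le_mul_of_nonneg_right ?_ hx
  have hsub : Finset.Icc (k - k / 2) k ⊆
      {j ∈ Finset.Icc (m + 1) n | k ∈ Finset.Icc j (2 * j)} := by
    intro j hj
    simp only [Finset.mem_filter, Finset.mem_Icc] at hj ⊢
    omega
  have hcard := Finset.card_le_card hsub
  rw [Nat.card_Icc] at hcard
  exact_mod_cast (by omega :
    k ≤ 2 * ({j ∈ Finset.Icc (m + 1) n | k ∈ Finset.Icc j (2 * j)} : Finset ℕ).card)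

/-- For `λ ∈ GBV` and `m < n`:
`∑_{k=m+1}^n k |λ_k - λ_{k+1}| ≤ C (∑_{k=m+1}^n λ_k + m λ_m)`. -/
theorem stmt_15 (lam : ℕ → ℝ) (hnn : ∀ n, 0 ≤ lam n) (hlim : Tendsto lam atTop (nhds 0))
    (hGBV : ∃ M : ℝ, 0 < M ∧ ∀ m : ℕ, 1 ≤ m →
      ∑ n ∈ Finset.Icc m (2 * m), |lam n - lam (n + 1)| ≤ M * lam m) :
    ∃ C : ℝ, 0 < C ∧ ∀ m n : ℕ, 1 ≤ m → m < n →
      ∑ k ∈ Finset.Icc (m + 1) n, (k : ℝ) * |lam k - lam (k + 1)| ≤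
        C * (∑ k ∈ Finset.Icc (m + 1) n, lam k + (m : ℝ) * lam m) := by
  obtain ⟨M, hM, h⟩ := hGBV
  refine ⟨2 * M, by positivity, fun m n hm _ => ?_⟩
  set d : ℕ → ℝ := fun k => |lam k - lam (k + 1)|
  have hd : ∀ k, 0 ≤ d k := fun k => abs_nonneg _
  have hblock : ∀ j, 1 ≤ j → ∑ k ∈ Finset.Icc (m + 1) n,
      (if k ∈ Finset.Icc j (2 * j) then d k else 0) ≤ M * lam j :=
    fun j hj => (sum_ite_mem_Icc_le hd _ j).trans (h j hj)
  calc ∑ k ∈ Finset.Icc (m + 1) n, (k : ℝ) * d k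
      ≤ ∑ k ∈ Finset.Icc (m + 1) n,
          (2 * m * (if k ∈ Finset.Icc m (2 * m) then d k else 0) +
            2 * ∑ j ∈ Finset.Icc (m + 1) n,
              (if k ∈ Finset.Icc j (2 * j) then d k else 0)) := by
        refine Finset.sum_le_sum fun k hk => ?_
        rw [Finset.mem_Icc] at hk
        rcases le_or_gt k (2 * m) with hkm | hkm
        · rw [if_pos (Finset.mem_Icc.2 ⟨by omega, hkm⟩)]
          have hk' : (k : ℝ) ≤ 2 * m := by exact_mod_cast hkm
          refine (mul_le_mul_of_nonneg_right hk' (hd k)).trans (le_add_of_nonneg_right ?_)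
          refine mul_nonneg zero_le_two (Finset.sum_nonneg fun j _ => ?_)
          split_ifs
          exacts [hd k, le_rfl]
        · refine (mul_le_two_mul_sum_ite_mem_Icc hkm hk.2 (hd k)).trans
            (le_add_of_nonneg_left (mul_nonneg (by positivity) ?_))
          split_ifs
          exacts [hd k, le_rfl]
    _ = 2 * m * ∑ k ∈ Finset.Icc (m + 1) n, (if k ∈ Finset.Icc m (2 * m) then d k else 0) +
          2 * ∑ j ∈ Finset.Icc (m + 1) n, ∑ k ∈ Finset.Icc (m + 1) n,
            (if k ∈ Finset.Icc j (2 * j) then d k else 0) := by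
        rw [Finset.sum_add_distrib, ← Finset.mul_sum, ← Finset.mul_sum, Finset.sum_comm]
    _ ≤ 2 * m * (M * lam m) + 2 * ∑ j ∈ Finset.Icc (m + 1) n, M * lam j := by
        gcongr with j hj
        · exact hblock m hm
        · exact hblock j (by rw [Finset.mem_Icc] at hj; omega)
    _ = 2 * M * (∑ k ∈ Finset.Icc (m + 1) n, lam k + (m : ℝ) * lam m) := by
        rw [← Finset.mul_sum]
        ring
end

section
/- Let λ = (λ_n)_{n≥1} be a nonnegative sequence in the class GBV. Then there is a constant C > 0 (depending only on λ) such that for every n ≥ 1, λ_{n+1} ≤ C ∑_{k=⌊n/2⌋+1}^{2n} k^{−1} λ_k. -/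
open Filter

/-- A bound on the variation of `c` over `[m, 2m]` controls later terms of that block by `c m`. -/
lemma le_of_sum_abs_sub_le {c : ℕ → ℝ} {M : ℝ} {m n : ℕ} (hmn : m ≤ n) (hn : n ≤ 2 * m)
    (h : ∑ j ∈ Finset.Icc m (2 * m), |c j - c (j + 1)| ≤ M * c m) :
    c (n + 1) ≤ (1 + M) * c m := by
  have h1 : dist (c m) (c (n + 1)) ≤ ∑ j ∈ Finset.Ico m (n + 1), dist (c j) (c (j + 1)) :=
    dist_le_Ico_sum_dist c (by omega)
  have h2 : ∑ j ∈ Finset.Ico m (n + 1), |c j - c (j + 1)| ≤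
      ∑ j ∈ Finset.Icc m (2 * m), |c j - c (j + 1)| := by
    refine Finset.sum_le_sum_of_subset_of_nonneg (fun j hj => ?_) fun _ _ _ => abs_nonneg _
    simp only [Finset.mem_Ico, Finset.mem_Icc] at hj ⊢
    omega
  simp only [Real.dist_eq] at h1
  linarith [neg_abs_le (c m - c (n + 1))]

/-- For `λ ∈ GBV`: `λ_{n+1} ≤ C ∑_{k=⌊n/2⌋+1}^{2n} k⁻¹ λ_k`. -/
theorem stmt_17 (lam : ℕ → ℝ) (hnn : ∀ n, 0 ≤ lam n) (hlim : Tendsto lam atTop (nhds 0))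
    (hGBV : ∃ M : ℝ, 0 < M ∧ ∀ m : ℕ, 1 ≤ m →
      ∑ n ∈ Finset.Icc m (2 * m), |lam n - lam (n + 1)| ≤ M * lam m) :
    ∃ C : ℝ, 0 < C ∧ ∀ n : ℕ, 1 ≤ n →
      lam (n + 1) ≤ C * ∑ k ∈ Finset.Icc (n / 2 + 1) (2 * n), (k : ℝ)⁻¹ * lam k := by
  obtain ⟨M, hM, hvar⟩ := hGBV
  refine ⟨2 * (1 + M), by positivity, fun n hn => ?_⟩
  have hn0 : (0 : ℝ) < n := by exact_mod_cast hn
  have hterm : ∀ k ∈ Finset.Icc (n / 2 + 1) n,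
      (n : ℝ)⁻¹ * lam (n + 1) ≤ (1 + M) * ((k : ℝ)⁻¹ * lam k) := by
    intro k hk
    rw [Finset.mem_Icc] at hk
    have hk0 : (0 : ℝ) < k := by exact_mod_cast (by omega : 0 < k)
    have hkn : (k : ℝ) ≤ n := by exact_mod_cast hk.2
    have hle := le_of_sum_abs_sub_le hk.2 (by omega) (hvar k (by omega))
    calc (n : ℝ)⁻¹ * lam (n + 1) ≤ (k : ℝ)⁻¹ * ((1 + M) * lam k) :=
          mul_le_mul (inv_anti₀ hk0 hkn) hle (hnn _) (by positivity)
      _ = (1 + M) * ((k : ℝ)⁻¹ * lam k) := by ring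
  have hcard : (n : ℝ) ≤ 2 * (Finset.Icc (n / 2 + 1) n).card := by
    rw [Nat.card_Icc]
    exact_mod_cast (by omega : n ≤ 2 * (n + 1 - (n / 2 + 1)))
  have hsum := Finset.card_nsmul_le_sum _ _ _ hterm
  rw [nsmul_eq_mul, ← Finset.mul_sum] at hsum
  have hsub : ∑ k ∈ Finset.Icc (n / 2 + 1) n, (k : ℝ)⁻¹ * lam k ≤
      ∑ k ∈ Finset.Icc (n / 2 + 1) (2 * n), (k : ℝ)⁻¹ * lam k :=
    Finset.sum_le_sum_of_subset_of_nonneg (Finset.Icc_subset_Icc_right (by omega))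
      fun k _ _ => mul_nonneg (by positivity) (hnn k)
  calc lam (n + 1) = n * ((n : ℝ)⁻¹ * lam (n + 1)) := by field_simp
    _ ≤ 2 * (Finset.Icc (n / 2 + 1) n).card * ((n : ℝ)⁻¹ * lam (n + 1)) :=
        mul_le_mul_of_nonneg_right hcard (mul_nonneg (by positivity) (hnn _))
    _ ≤ 2 * ((1 + M) * ∑ k ∈ Finset.Icc (n / 2 + 1) n, (k : ℝ)⁻¹ * lam k) := by linarith
    _ ≤ 2 * ((1 + M) * ∑ k ∈ Finset.Icc (n / 2 + 1) (2 * n), (k : ℝ)⁻¹ * lam k) := by gcongr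
    _ = _ := by ring
end

section
/- Let 1 < p < ∞. There is a constant C > 0 (depending only on p) such that for every nonnegative sequence λ = (λ_n)_{n≥1} and every n ≥ 1, ∑_{m=n}^∞ m^{p−2} ( ∑_{k=m}^∞ k^{−1} λ_k )^p ≤ C ∑_{m=n}^∞ m^{p−2} λ_m^p, where both sides are interpreted in the extended nonnegative reals. -/
/-- Weighted Hölder inequality for series in `[0, ∞]`. -/
theorem ENNReal.tsum_mul_rpow_le_weight_mul_Lp {p : ℝ} (hp : 1 ≤ p) (w f : ℕ → ENNReal) :
    (∑' k, w k * f k) ^ p ≤ (∑' k, w k) ^ (p - 1) * ∑' k, w k * f k ^ p := by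
  have hp0 : 0 < p := by linarith
  have key : ∑' k, w k * f k ≤ (∑' k, w k) ^ (1 - p⁻¹) * (∑' k, w k * f k ^ p) ^ p⁻¹ := by
    rw [ENNReal.tsum_eq_iSup_sum]
    refine iSup_le fun s => (ENNReal.inner_le_weight_mul_Lp_of_nonneg s hp w f).trans ?_
    have h1 : 0 ≤ 1 - p⁻¹ := sub_nonneg.2 (inv_le_one_of_one_le₀ hp)
    gcongr <;> exact ENNReal.sum_le_tsum s
  calc (∑' k, w k * f k) ^ p
      ≤ ((∑' k, w k) ^ (1 - p⁻¹) * (∑' k, w k * f k ^ p) ^ p⁻¹) ^ p := by gcongr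
    _ = _ := by
      rw [ENNReal.mul_rpow_of_nonneg _ _ hp0.le, ← ENNReal.rpow_mul, ← ENNReal.rpow_mul,
        inv_mul_cancel₀ hp0.ne', ENNReal.rpow_one, sub_mul, inv_mul_cancel₀ hp0.ne', one_mul]

/-- Interchange of summation over the triangle `m ≤ i` in `[0, ∞]`. -/
theorem ENNReal.tsum_tsum_add_eq_tsum_sum_range (F : ℕ → ℕ → ENNReal) :
    ∑' m, ∑' k, F m (m + k) = ∑' i, ∑ m ∈ Finset.range (i + 1), F m i := by
  rw [← ENNReal.tsum_prod (f := fun m k => F m (m + k)),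
    ← Finset.HasAntidiagonal.sigmaAntidiagonalEquivProd.tsum_eq, ENNReal.tsum_sigma']
  refine tsum_congr fun i => ?_
  rw [tsum_fintype]
  simp only [Finset.HasAntidiagonal.sigmaAntidiagonalEquivProd_apply]
  rw [Finset.sum_coe_sort (Finset.HasAntidiagonal.antidiagonal i) (fun x => F x.1 (x.1 + x.2)),
    Finset.Nat.sum_antidiagonal_eq_sum_range_succ_mk]
  refine Finset.sum_congr rfl fun m hm => ?_
  rw [Nat.add_sub_cancel' (Nat.lt_succ_iff.1 (Finset.mem_range.1 hm))]

theorem Real.add_one_rpow_sub_one_le {s x : ℝ} (hs : 0 < s) (hx : 0 < x) :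
    (x + 1) ^ (s - 1) ≤ (1 + s⁻¹) * ((x + 1) ^ s - x ^ s) := by
  have hx1 : 0 < x + 1 := by linarith
  have hsplit : (x + 1) ^ s = (x + 1) ^ (s - 1) * (x + 1) := by
    rw [Real.rpow_sub_one hx1.ne']; field_simp
  have hpos : 0 < (x + 1) ^ (s - 1) := Real.rpow_pos_of_pos hx1 _
  have hsi : 0 < s⁻¹ := inv_pos.2 hs
  rcases le_total 1 s with h | h
  · have h1 : x ^ s ≤ (x + 1) ^ (s - 1) * x := by
      have : x ^ s = x ^ (s - 1) * x := by
        rw [Real.rpow_sub_one hx.ne']; field_simp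
      rw [this]
      gcongr
      linarith
    nlinarith
  · have hb := rpow_one_add_le_one_add_mul_self (s := -(x + 1)⁻¹) (p := s)
      (by have := inv_le_one_of_one_le₀ (show 1 ≤ x + 1 by linarith); linarith) hs.le h
    have he : 1 + -(x + 1)⁻¹ = x / (x + 1) := by field_simp; ring
    rw [he, Real.div_rpow hx.le hx1.le, div_le_iff₀ (Real.rpow_pos_of_pos hx1 _)] at hb
    have hb2 : x ^ s ≤ (x + 1) ^ s - s * (x + 1) ^ (s - 1) := by
      calc _ ≤ _ := hb
        _ = _ := by rw [hsplit]; field_simp; ring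
    have : s⁻¹ * (s * (x + 1) ^ (s - 1)) = (x + 1) ^ (s - 1) := by field_simp
    have h3 : 0 < s * (x + 1) ^ (s - 1) := by positivity
    nlinarith

theorem Real.sum_range_add_rpow_sub_one_le {s : ℝ} (hs : 0 < s) {n : ℕ} (hn : 1 ≤ n) (i : ℕ) :
    ∑ m ∈ Finset.range (i + 1), ((n + m : ℕ) : ℝ) ^ (s - 1) ≤
      (1 + s⁻¹) * ((n + i : ℕ) : ℝ) ^ s := by
  have hsi : 0 < s⁻¹ := inv_pos.2 hs
  have hn' : (1 : ℝ) ≤ n := by exact_mod_cast hn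
  induction i with
  | zero =>
    simp only [zero_add, Finset.range_one, Finset.sum_singleton, add_zero]
    have h1 : (n : ℝ) ^ (s - 1) ≤ (n : ℝ) ^ s :=
      Real.rpow_le_rpow_of_exponent_le hn' (by linarith)
    have h2 : 0 ≤ (n : ℝ) ^ s := by positivity
    nlinarith
  | succ i ih =>
    rw [Finset.sum_range_succ]
    have h := Real.add_one_rpow_sub_one_le hs (x := ((n + i : ℕ) : ℝ)) (by positivity)
    have he : ((n + (i + 1) : ℕ) : ℝ) = ((n + i : ℕ) : ℝ) + 1 := by push_cast; ring
    rw [he]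
    linarith

theorem Real.rpow_neg_three_halves_le {x : ℝ} (hx : 1 ≤ x) :
    x ^ (-(3 / 2) : ℝ) ≤ 4 * (x ^ (-(1 / 2) : ℝ) - (x + 1) ^ (-(1 / 2) : ℝ)) := by
  have hx0 : 0 < x := by linarith
  have h1 : x ^ (-(3 / 2) : ℝ) = (x * √x)⁻¹ := by
    rw [Real.rpow_neg hx0.le, show (3 / 2 : ℝ) = 1 + 1 / 2 by norm_num, Real.rpow_add hx0,
      Real.rpow_one, Real.sqrt_eq_rpow]
  have h2 : ∀ y : ℝ, 0 < y → y ^ (-(1 / 2) : ℝ) = (√y)⁻¹ := fun y hy => by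
    rw [Real.rpow_neg hy.le, Real.sqrt_eq_rpow]
  rw [h1, h2 x hx0, h2 (x + 1) (by linarith)]
  have ha : 0 < √x := Real.sqrt_pos.2 hx0
  have hb : 0 < √(x + 1) := Real.sqrt_pos.2 (by linarith)
  have ha2 : √x ^ 2 = x := Real.sq_sqrt hx0.le
  have hb2 : √(x + 1) ^ 2 = x + 1 := Real.sq_sqrt (by linarith)
  generalize √x = a at *
  generalize √(x + 1) = b at *
  have hba : b ≤ 3 / 2 * a := by
    refine le_of_sq_le_sq ?_ (by positivity)
    nlinarith
  have hd : a⁻¹ - b⁻¹ = (a * b * (a + b))⁻¹ := by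
    have h : (b - a) * (b + a) = 1 := by nlinarith
    field_simp
    linarith
  rw [hd, ← ha2, ← div_eq_mul_inv, inv_eq_one_div, div_le_div_iff₀ (by positivity) (by positivity)]
  have : b * (a + b) ≤ (3 / 2 * a) * (a + 3 / 2 * a) := by gcongr
  nlinarith

theorem ENNReal.tsum_ofReal_rpow_neg_three_halves_le {N : ℕ} (hN : 1 ≤ N) :
    ∑' k : ℕ, ENNReal.ofReal (((N + k : ℕ) : ℝ) ^ (-(3 / 2) : ℝ)) ≤
      ENNReal.ofReal (4 * (N : ℝ) ^ (-(1 / 2) : ℝ)) := by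
  refine ENNReal.tsum_le_of_sum_range_le fun i => ?_
  rw [← ENNReal.ofReal_sum_of_nonneg fun _ _ => by positivity]
  refine ENNReal.ofReal_le_ofReal ?_
  have h : ∑ k ∈ Finset.range i, ((N + k : ℕ) : ℝ) ^ (-(3 / 2) : ℝ) ≤
      4 * ((N : ℝ) ^ (-(1 / 2) : ℝ) - ((N + i : ℕ) : ℝ) ^ (-(1 / 2) : ℝ)) := by
    induction i with
    | zero => simp
    | succ i ih =>
      rw [Finset.sum_range_succ]
      have h := Real.rpow_neg_three_halves_le (x := ((N + i : ℕ) : ℝ))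
        (by exact_mod_cast hN.trans (Nat.le_add_right _ _))
      have he : ((N + (i + 1) : ℕ) : ℝ) = ((N + i : ℕ) : ℝ) + 1 := by push_cast; ring
      rw [he]
      linarith
  have : 0 ≤ ((N + i : ℕ) : ℝ) ^ (-(1 / 2) : ℝ) := by positivity
  linarith

theorem ENNReal.tail_tsum_rpow_le {p : ℝ} (hp : 1 < p) {lam : ℕ → ℝ} (hlam : ∀ n, 0 ≤ lam n)
    {N : ℕ} (hN : 1 ≤ N) :
    (∑' k : ℕ, ENNReal.ofReal (((N + k : ℕ) : ℝ)⁻¹ * lam (N + k))) ^ p ≤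
      ENNReal.ofReal (4 ^ (p - 1) * (N : ℝ) ^ (-((p - 1) / 2))) *
        ∑' k : ℕ, ENNReal.ofReal (((N + k : ℕ) : ℝ) ^ ((p - 1) / 2 - 1) * lam (N + k) ^ p) := by
  have hpos : ∀ k : ℕ, (0 : ℝ) < ((N + k : ℕ) : ℝ) := fun k => by
    exact_mod_cast hN.trans (Nat.le_add_right _ _)
  have hp0 : 0 ≤ p := by linarith
  have h := ENNReal.tsum_mul_rpow_le_weight_mul_Lp hp.le
    (fun k => ENNReal.ofReal (((N + k : ℕ) : ℝ) ^ (-(3 / 2) : ℝ)))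
    (fun k => ENNReal.ofReal (((N + k : ℕ) : ℝ) ^ (1 / 2 : ℝ) * lam (N + k)))
  have e1 : ∀ k : ℕ, ENNReal.ofReal (((N + k : ℕ) : ℝ) ^ (-(3 / 2) : ℝ)) *
      ENNReal.ofReal (((N + k : ℕ) : ℝ) ^ (1 / 2 : ℝ) * lam (N + k)) =
      ENNReal.ofReal (((N + k : ℕ) : ℝ)⁻¹ * lam (N + k)) := fun k => by
    rw [← ENNReal.ofReal_mul (by positivity), ← mul_assoc, ← Real.rpow_add (hpos k),
      ← Real.rpow_neg_one]
    norm_num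
  have e2 : ∀ k : ℕ, ENNReal.ofReal (((N + k : ℕ) : ℝ) ^ (-(3 / 2) : ℝ)) *
      ENNReal.ofReal (((N + k : ℕ) : ℝ) ^ (1 / 2 : ℝ) * lam (N + k)) ^ p =
      ENNReal.ofReal (((N + k : ℕ) : ℝ) ^ ((p - 1) / 2 - 1) * lam (N + k) ^ p) := fun k => by
    have hl := hlam (N + k)
    rw [ENNReal.ofReal_rpow_of_nonneg (by positivity) hp0, ← ENNReal.ofReal_mul (by positivity),
      Real.mul_rpow (by positivity) hl, ← mul_assoc, ← Real.rpow_mul (hpos k).le,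
      ← Real.rpow_add (hpos k)]
    congr 3
    ring
  simp only [e1, e2] at h
  refine h.trans ?_
  gcongr
  calc _ ≤ ENNReal.ofReal (4 * (N : ℝ) ^ (-(1 / 2) : ℝ)) ^ (p - 1) :=
        ENNReal.rpow_le_rpow (ENNReal.tsum_ofReal_rpow_neg_three_halves_le hN) (by linarith)
    _ = _ := by
      rw [ENNReal.ofReal_rpow_of_nonneg (by positivity) (by linarith),
        Real.mul_rpow (by norm_num) (by positivity), ← Real.rpow_mul (by positivity)]
      congr 3
      ring

/-- Tail Hardy-type inequality:
`∑_{m≥n} m^{p-2} (∑_{k≥m} k⁻¹ λ_k)^p ≤ C ∑_{m≥n} m^{p-2} λ_m^p` in `[0,∞]`. -/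
theorem stmt_18 (p : ℝ) (hp1 : 1 < p) :
    ∃ C : ℝ, 0 < C ∧ ∀ lam : ℕ → ℝ, (∀ n, 0 ≤ lam n) → ∀ n : ℕ, 1 ≤ n →
      ∑' m : ℕ, ENNReal.ofReal (((n + m : ℕ) : ℝ) ^ (p - 2)) *
          (∑' k : ℕ, ENNReal.ofReal (((n + m + k : ℕ) : ℝ)⁻¹ * lam (n + m + k))) ^ p ≤
        ENNReal.ofReal C *
          ∑' m : ℕ, ENNReal.ofReal (((n + m : ℕ) : ℝ) ^ (p - 2) * lam (n + m) ^ p) := by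
  obtain ⟨s, hs⟩ : ∃ s, s = (p - 1) / 2 := ⟨_, rfl⟩
  have hs0 : 0 < s := by linarith
  refine ⟨4 ^ (p - 1) * (1 + s⁻¹), by positivity, fun lam hlam n hn => ?_⟩
  have hpos : ∀ k : ℕ, (0 : ℝ) < ((n + k : ℕ) : ℝ) := fun k => by
    exact_mod_cast hn.trans (Nat.le_add_right _ _)
  have hl : ∀ k, 0 ≤ lam k ^ p := fun k => Real.rpow_nonneg (hlam k) p
  calc _ ≤ ∑' m : ℕ, ∑' k : ℕ, ENNReal.ofReal (4 ^ (p - 1) * ((n + m : ℕ) : ℝ) ^ (s - 1)) *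
        ENNReal.ofReal (((n + (m + k) : ℕ) : ℝ) ^ (s - 1) * lam (n + (m + k)) ^ p) := by
        refine ENNReal.tsum_le_tsum fun m => ?_
        rw [ENNReal.tsum_mul_left]
        refine (mul_le_mul_right (ENNReal.tail_tsum_rpow_le hp1 hlam
          (hn.trans (Nat.le_add_right n m))) _).trans_eq ?_
        rw [← mul_assoc, ← ENNReal.ofReal_mul (by positivity), mul_left_comm,
          ← Real.rpow_add (hpos m), show p - 2 + -((p - 1) / 2) = s - 1 by rw [hs]; ring, ← hs]
        simp only [add_assoc]
    _ = ∑' i : ℕ, ∑ m ∈ Finset.range (i + 1),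
        ENNReal.ofReal (4 ^ (p - 1) * ((n + m : ℕ) : ℝ) ^ (s - 1)) *
        ENNReal.ofReal (((n + i : ℕ) : ℝ) ^ (s - 1) * lam (n + i) ^ p) :=
        ENNReal.tsum_tsum_add_eq_tsum_sum_range fun m i =>
          ENNReal.ofReal (4 ^ (p - 1) * ((n + m : ℕ) : ℝ) ^ (s - 1)) *
          ENNReal.ofReal (((n + i : ℕ) : ℝ) ^ (s - 1) * lam (n + i) ^ p)
    _ ≤ _ := by
        rw [← ENNReal.tsum_mul_left]
        refine ENNReal.tsum_le_tsum fun i => ?_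
        have hli := hl (n + i)
        rw [← Finset.sum_mul, ← ENNReal.ofReal_sum_of_nonneg fun _ _ => by positivity,
          ← ENNReal.ofReal_mul (Finset.sum_nonneg fun _ _ => by positivity),
          ← ENNReal.ofReal_mul (by positivity), ← Finset.mul_sum]
        refine ENNReal.ofReal_le_ofReal ?_
        calc _ ≤ 4 ^ (p - 1) * ((1 + s⁻¹) * ((n + i : ℕ) : ℝ) ^ s) *
              (((n + i : ℕ) : ℝ) ^ (s - 1) * lam (n + i) ^ p) := by
              gcongr
              exact Real.sum_range_add_rpow_sub_one_le hs0 hn i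
          _ = _ := by
              rw [show p - 2 = s + (s - 1) by rw [hs]; ring, Real.rpow_add (hpos i)]
              ring
end

section
/- Let 1 < p < ∞. There is a constant C > 0 (depending only on p) such that for every nonnegative sequence λ = (λ_n)_{n≥1} and every n ≥ 1, ∑_{m=n}^∞ m^{−2} ( ∑_{k=n}^m λ_k )^p ≤ C ∑_{m=n}^∞ m^{p−2} λ_m^p, where both sides are interpreted in the extended nonnegative reals. -/
open Finset in
/-- The weighted power mean inequality in the form `(∑ wf)^p ≤ (∑ w)^(p-1) ∑ w f^p`. -/
lemma Real.sum_mul_rpow_le_weight_mul_sum {ι : Type*} (t : Finset ι) {p : ℝ} (hp : 1 ≤ p)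
    (w f : ι → ℝ) (hw : ∀ i, 0 ≤ w i) (hf : ∀ i, 0 ≤ f i) :
    (∑ i ∈ t, w i * f i) ^ p ≤ (∑ i ∈ t, w i) ^ (p - 1) * ∑ i ∈ t, w i * f i ^ p := by
  have hp0 : 0 < p := by linarith
  have hW : 0 ≤ ∑ i ∈ t, w i := sum_nonneg fun i _ => hw i
  have hF : 0 ≤ ∑ i ∈ t, w i * f i ^ p :=
    sum_nonneg fun i _ => mul_nonneg (hw i) (Real.rpow_nonneg (hf i) p)
  calc (∑ i ∈ t, w i * f i) ^ p
      ≤ ((∑ i ∈ t, w i) ^ (1 - p⁻¹) * (∑ i ∈ t, w i * f i ^ p) ^ p⁻¹) ^ p :=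
        Real.rpow_le_rpow (sum_nonneg fun i _ => mul_nonneg (hw i) (hf i))
          (Real.inner_le_weight_mul_Lp_of_nonneg t hp w f hw hf) hp0.le
    _ = _ := by
        rw [Real.mul_rpow (by positivity) (by positivity), ← Real.rpow_mul hW,
          ← Real.rpow_mul hF, inv_mul_cancel₀ hp0.ne', Real.rpow_one]
        congr 2
        field_simp

/-- A lower bound for the increments of a power with exponent in `[0, 1]`. -/
lemma Real.mul_rpow_sub_one_le_rpow_sub_rpow {s x : ℝ} (hs0 : 0 ≤ s) (hs1 : s ≤ 1) (hx : 0 ≤ x) :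
    s * (x + 1) ^ (s - 1) ≤ (x + 1) ^ s - x ^ s := by
  have hx1 : 0 < x + 1 := by linarith
  have hbern := rpow_one_add_le_one_add_mul_self (s := -(x + 1)⁻¹)
    (by rw [neg_le_neg_iff]; exact inv_le_one_of_one_le₀ (by linarith)) hs0 hs1
  have hdiv : 1 + -(x + 1)⁻¹ = x / (x + 1) := by field_simp; ring
  rw [hdiv, Real.div_rpow hx hx1.le, div_le_iff₀ (Real.rpow_pos_of_pos hx1 s)] at hbern
  rw [Real.rpow_sub_one hx1.ne', div_eq_mul_inv]
  linarith

/-- An upper bound for `x ^ (-1 - s)` by decrements of `x ^ (-s)`. -/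
lemma Real.rpow_neg_one_sub_le_rpow_neg_sub {s x : ℝ} (hs0 : 0 < s) (hs1 : s ≤ 1) (hx : 1 ≤ x) :
    x ^ (-1 - s) ≤ 2 / s * (x ^ (-s) - (x + 1) ^ (-s)) := by
  have hx0 : 0 < x := by linarith
  have hx1 : 0 < x + 1 := by linarith
  have h := Real.mul_rpow_sub_one_le_rpow_sub_rpow hs0.le hs1 hx0.le
  have e : x ^ (-1 - s) = x⁻¹ * (x ^ s)⁻¹ := by
    rw [sub_eq_add_neg, Real.rpow_add hx0, Real.rpow_neg_one, Real.rpow_neg hx0.le]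
  rw [Real.rpow_sub_one hx1.ne'] at h
  rw [e, Real.rpow_neg hx0.le, Real.rpow_neg hx1.le]
  have ha : 0 < x ^ s := Real.rpow_pos_of_pos hx0 s
  have hb : 0 < (x + 1) ^ s := Real.rpow_pos_of_pos hx1 s
  set a := x ^ s
  set b := (x + 1) ^ s
  have h2 : s / (x + 1) ≤ (b - a) / b := by
    rw [le_div_iff₀ hb]
    calc s / (x + 1) * b = s * (b / (x + 1)) := by ring
      _ ≤ b - a := h
  have h3 : x⁻¹ ≤ 2 / (x + 1) := by
    rw [inv_eq_one_div, div_le_div_iff₀ hx0 hx1]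
    linarith
  calc x⁻¹ * a⁻¹ ≤ 2 / (x + 1) * a⁻¹ := by gcongr
    _ = 2 / s * (s / (x + 1) * a⁻¹) := by field_simp
    _ ≤ 2 / s * ((b - a) / b * a⁻¹) := by gcongr
    _ = 2 / s * (a⁻¹ - b⁻¹) := by field_simp

open Finset in
lemma sum_range_rpow_sub_one_le {s : ℝ} (hs0 : 0 < s) (hs1 : s ≤ 1) {n : ℕ} (hn : 1 ≤ n)
    (m : ℕ) :
    ∑ j ∈ range (m + 1), ((n + j : ℕ) : ℝ) ^ (s - 1) ≤ ((n + m : ℕ) : ℝ) ^ s / s := by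
  have step (k : ℕ) : ((k + 1 : ℕ) : ℝ) ^ (s - 1) ≤
      ((k + 1 : ℕ) : ℝ) ^ s / s - (k : ℝ) ^ s / s := by
    rw [← sub_div, le_div_iff₀ hs0, mul_comm]
    exact_mod_cast Real.mul_rpow_sub_one_le_rpow_sub_rpow hs0.le hs1 (Nat.cast_nonneg k)
  induction m with
  | zero =>
    obtain ⟨k, rfl⟩ := Nat.exists_eq_add_of_le' hn
    have hk : 0 ≤ (k : ℝ) ^ s / s := by positivity
    simpa using (step k).trans (sub_le_self _ hk)
  | succ m ih =>
    rw [sum_range_succ]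
    have h := step (n + m)
    rw [← add_assoc]
    linarith

open Finset in
lemma tsum_ite_rpow_neg_one_sub_le {s : ℝ} (hs0 : 0 < s) (hs1 : s ≤ 1) {n : ℕ} (hn : 1 ≤ n)
    (j : ℕ) :
    ∑' m : ℕ, (if j ≤ m then ENNReal.ofReal (((n + m : ℕ) : ℝ) ^ (-1 - s)) else 0) ≤
      ENNReal.ofReal (2 / s * ((n + j : ℕ) : ℝ) ^ (-s)) := by
  have partial_sum (N : ℕ) :
      ∑ m ∈ range N, (if j ≤ m then ((n + m : ℕ) : ℝ) ^ (-1 - s) else 0) ≤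
        2 / s * (((n + j : ℕ) : ℝ) ^ (-s) - ((n + max j N : ℕ) : ℝ) ^ (-s)) := by
    induction N with
    | zero => simp
    | succ N ih =>
      rw [sum_range_succ]
      split_ifs with h
      · have hstep := Real.rpow_neg_one_sub_le_rpow_neg_sub hs0 hs1
          (x := ((n + N : ℕ) : ℝ)) (by exact_mod_cast (by omega : 1 ≤ n + N))
        rw [max_eq_right h] at ih
        rw [max_eq_right (by omega), ← add_assoc, Nat.cast_succ (n + N)]
        linarith
      · rw [max_eq_left (by omega)] at ih ⊢
        simpa using ih
  refine ENNReal.tsum_le_of_sum_range_le fun N => ?_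
  have hofReal (m : ℕ) :
      (if j ≤ m then ENNReal.ofReal (((n + m : ℕ) : ℝ) ^ (-1 - s)) else 0) =
        ENNReal.ofReal (if j ≤ m then ((n + m : ℕ) : ℝ) ^ (-1 - s) else 0) := by
    split_ifs <;> simp
  simp_rw [hofReal]
  rw [← ENNReal.ofReal_sum_of_nonneg fun m _ => by positivity]
  refine ENNReal.ofReal_le_ofReal ((partial_sum N).trans ?_)
  gcongr
  exact sub_le_self _ (by positivity)

/-- The pointwise bound behind Hardy's inequality, with weights `k ^ (1 / p - 1)`. -/
lemma hardy_term_le {p : ℝ} (hp : 1 < p) {lam : ℕ → ℝ} (hlam : ∀ n, 0 ≤ lam n) {n : ℕ}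
    (hn : 1 ≤ n) (m : ℕ) :
    (((n + m : ℕ) : ℝ) ^ 2)⁻¹ * (∑ k ∈ Finset.Icc n (n + m), lam k) ^ p ≤
      p ^ (p - 1) * ((n + m : ℕ) : ℝ) ^ (-1 - p⁻¹) *
        ∑ j ∈ Finset.range (m + 1),
          ((n + j : ℕ) : ℝ) ^ (p - 2 + p⁻¹) * lam (n + j) ^ p := by
  have hp0 : 0 < p := by linarith
  have hpos (j : ℕ) : 0 < ((n + j : ℕ) : ℝ) := by exact_mod_cast (by omega : 0 < n + j)
  have hIcc : ∑ k ∈ Finset.Icc n (n + m), lam k = ∑ j ∈ Finset.range (m + 1),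
      ((n + j : ℕ) : ℝ) ^ (p⁻¹ - 1) * (((n + j : ℕ) : ℝ) ^ (1 - p⁻¹) * lam (n + j)) := by
    rw [← Finset.Ico_add_one_right_eq_Icc, Finset.sum_Ico_eq_sum_range,
      show n + m + 1 - n = m + 1 by omega]
    refine Finset.sum_congr rfl fun j _ => ?_
    rw [← mul_assoc, ← Real.rpow_add (hpos j)]
    simp
  have hsum : ∑ j ∈ Finset.range (m + 1), ((n + j : ℕ) : ℝ) ^ (p⁻¹ - 1) *
        (((n + j : ℕ) : ℝ) ^ (1 - p⁻¹) * lam (n + j)) ^ p =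
      ∑ j ∈ Finset.range (m + 1), ((n + j : ℕ) : ℝ) ^ (p - 2 + p⁻¹) * lam (n + j) ^ p := by
    refine Finset.sum_congr rfl fun j _ => ?_
    rw [Real.mul_rpow (by positivity) (hlam _), ← Real.rpow_mul (hpos j).le, ← mul_assoc,
      ← Real.rpow_add (hpos j)]
    congr 2
    field_simp
    ring
  have hpow : (((n + m : ℕ) : ℝ) ^ 2)⁻¹ * (((n + m : ℕ) : ℝ) ^ p⁻¹ / p⁻¹) ^ (p - 1) =
      p ^ (p - 1) * ((n + m : ℕ) : ℝ) ^ (-1 - p⁻¹) := by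
    rw [div_inv_eq_mul, Real.mul_rpow (by positivity) hp0.le, ← Real.rpow_mul (hpos m).le,
      ← Real.rpow_natCast, ← Real.rpow_neg (hpos m).le, ← mul_assoc, ← Real.rpow_add (hpos m),
      mul_comm]
    congr 2
    push_cast
    field_simp
    ring
  have hF : 0 ≤ ∑ j ∈ Finset.range (m + 1),
      ((n + j : ℕ) : ℝ) ^ (p - 2 + p⁻¹) * lam (n + j) ^ p :=
    Finset.sum_nonneg fun j _ => mul_nonneg (by positivity) (Real.rpow_nonneg (hlam _) p)
  have hmean := Real.sum_mul_rpow_le_weight_mul_sum (Finset.range (m + 1)) hp.le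
    (fun j => ((n + j : ℕ) : ℝ) ^ (p⁻¹ - 1))
    (fun j => ((n + j : ℕ) : ℝ) ^ (1 - p⁻¹) * lam (n + j))
    (fun j => by positivity) (fun j => mul_nonneg (by positivity) (hlam _))
  have hweight := sum_range_rpow_sub_one_le (inv_pos.2 hp0) (inv_le_one_of_one_le₀ hp.le) hn m
  rw [← hIcc, hsum] at hmean
  rw [← hpow, mul_assoc]
  refine mul_le_mul_of_nonneg_left (hmean.trans ?_) (by positivity)
  refine mul_le_mul_of_nonneg_right ?_ hF
  exact Real.rpow_le_rpow (by positivity) hweight (by linarith)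

/-- Hardy-type inequality:
`∑_{m≥n} m⁻² (∑_{k=n}^m λ_k)^p ≤ C ∑_{m≥n} m^{p-2} λ_m^p` in `[0,∞]`. -/
theorem stmt_19 (p : ℝ) (hp1 : 1 < p) :
    ∃ C : ℝ, 0 < C ∧ ∀ lam : ℕ → ℝ, (∀ n, 0 ≤ lam n) → ∀ n : ℕ, 1 ≤ n →
      ∑' m : ℕ, ENNReal.ofReal ((((n + m : ℕ) : ℝ) ^ 2)⁻¹) *
          ENNReal.ofReal ((∑ k ∈ Finset.Icc n (n + m), lam k) ^ p) ≤
        ENNReal.ofReal C *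
          ∑' m : ℕ, ENNReal.ofReal (((n + m : ℕ) : ℝ) ^ (p - 2) * lam (n + m) ^ p) := by
  have hp0 : 0 < p := by linarith
  refine ⟨p ^ (p - 1) * (2 / p⁻¹), by positivity, fun lam hlam n hn => ?_⟩
  have hpos (j : ℕ) : 0 < ((n + j : ℕ) : ℝ) := by exact_mod_cast (by omega : 0 < n + j)
  set g : ℕ → ℝ := fun j => ((n + j : ℕ) : ℝ) ^ (p - 2 + p⁻¹) * lam (n + j) ^ p with hg
  have hg0 (j : ℕ) : 0 ≤ g j := mul_nonneg (by positivity) (Real.rpow_nonneg (hlam _) p)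
  set b : ℕ → ENNReal := fun m => ENNReal.ofReal (((n + m : ℕ) : ℝ) ^ (-1 - p⁻¹))
  set A : ENNReal := ENNReal.ofReal (p ^ (p - 1)) with hA
  have hterm (m : ℕ) : ENNReal.ofReal ((((n + m : ℕ) : ℝ) ^ 2)⁻¹) *
      ENNReal.ofReal ((∑ k ∈ Finset.Icc n (n + m), lam k) ^ p) ≤
        ∑' j : ℕ, A * ENNReal.ofReal (g j) * (if j ≤ m then b m else 0) := by
    rw [← ENNReal.ofReal_mul (by positivity)]
    refine (ENNReal.ofReal_le_ofReal (hardy_term_le hp1 hlam hn m)).trans ?_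
    rw [ENNReal.ofReal_mul (by positivity), ENNReal.ofReal_mul (by positivity),
      ENNReal.ofReal_sum_of_nonneg fun j _ => hg0 j, Finset.mul_sum]
    refine le_trans (le_of_eq (Finset.sum_congr rfl fun j hj => ?_))
      (ENNReal.sum_le_tsum (Finset.range (m + 1)))
    rw [if_pos (Finset.mem_range_succ_iff.1 hj)]
    exact mul_right_comm _ _ _
  calc _ ≤ ∑' m : ℕ, ∑' j : ℕ, A * ENNReal.ofReal (g j) * (if j ≤ m then b m else 0) :=
        ENNReal.tsum_le_tsum hterm
    _ = ∑' j : ℕ, A * ENNReal.ofReal (g j) * ∑' m : ℕ, (if j ≤ m then b m else 0) := by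
        rw [ENNReal.tsum_comm]
        simp_rw [ENNReal.tsum_mul_left]
    _ ≤ ∑' j : ℕ, A * ENNReal.ofReal (g j) *
          ENNReal.ofReal (2 / p⁻¹ * ((n + j : ℕ) : ℝ) ^ (-p⁻¹)) := by
        gcongr with j
        exact tsum_ite_rpow_neg_one_sub_le (inv_pos.2 hp0) (inv_le_one_of_one_le₀ hp1.le) hn j
    _ = _ := by
        rw [← ENNReal.tsum_mul_left]
        refine tsum_congr fun j => ?_
        rw [hA, ← ENNReal.ofReal_mul (by positivity),
          ← ENNReal.ofReal_mul (mul_nonneg (by positivity) (hg0 j)),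
          ← ENNReal.ofReal_mul (by positivity)]
        congr 1
        have hexp : ((n + j : ℕ) : ℝ) ^ (p - 2) =
            ((n + j : ℕ) : ℝ) ^ (p - 2 + p⁻¹) * ((n + j : ℕ) : ℝ) ^ (-p⁻¹) := by
          rw [← Real.rpow_add (hpos j)]
          simp
        rw [hexp, hg]
        ring
end
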